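/- arXiv:1502.06800 — 7 statements merged into one kernel-verified Lean document; each statement's English description precedes it below -/
import Mathlib

section
/- Assume the non-increasing sequence (μ_m)_{m≥1} of eigenvalues of Σ satisfies Σ_{m=j}^∞ μ_m ≤ γ j μ_j for all j ≥ 1 for some γ > 0. Let δ ∈ (0,1), let m be a positive integer with m ≤ n / (5(1+γ) log(16n/(5δ))), set λ = μ_m, let q*_λ(v) = ⟨φ(v,·), (Σ + λI)^{-1} φ(v,·)⟩_{L2(dρ)} / tr[Σ(Σ + λI)^{-1}], let v_1,…,v_n be sampled i.i.d. from q*_λ dτ, and let F̂ be the RKHS of k̂(x,y) = (1/n) Σ_{i=1}^n q*_λ(v_i)^{-1} φ(v_i,x)φ(v_i,y). Then with probability at least 1 − δ, sup over all f ∈ F with ‖f‖_F ≤ 1 of the infimum over f̂ ∈ F̂ with ‖f̂‖_{F̂} ≤ 2 of ‖f − f̂‖²_{L2(dρ)} is at most 4μ_m. -/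
open MeasureTheory
open scoped ENNReal RealInnerProductSpace

lemma Real.two_mul_exp_sub_one_le {x : ℝ} (hx : 0 ≤ x) :
    2 * (Real.exp x - 1) ≤ x * (Real.exp x + 1) := by
  let h : ℝ → ℝ := fun x => x * (Real.exp x + 1) - 2 * (Real.exp x - 1)
  have hd : ∀ x, HasDerivAt h (1 * (Real.exp x + 1) + x * Real.exp x - 2 * Real.exp x) x :=
    fun x => ((hasDerivAt_id x).mul ((Real.hasDerivAt_exp x).add_const 1)).sub
      (((Real.hasDerivAt_exp x).sub_const 1).const_mul 2)
  have hmono : MonotoneOn h (Set.Ici 0) := by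
    refine monotoneOn_of_deriv_nonneg (convex_Ici 0)
      (fun x _ => (hd x).continuousAt.continuousWithinAt)
      (fun x _ => (hd x).differentiableAt.differentiableWithinAt) fun x _ => ?_
    rw [(hd x).deriv]
    have h1 : (1 - x) * Real.exp x ≤ Real.exp (-x) * Real.exp x :=
      mul_le_mul_of_nonneg_right (by linarith [Real.add_one_le_exp (-x)]) (Real.exp_pos x).le
    rw [← Real.exp_add, neg_add_cancel, Real.exp_zero] at h1
    linarith
  have h0 := hmono Set.self_mem_Ici (show x ∈ Set.Ici 0 from hx) hx
  simp only [h, zero_mul, Real.exp_zero] at h0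
  linarith

lemma Real.sub_mul_exp_sub_exp_le (a b : ℝ) :
    (a - b) * (Real.exp a - Real.exp b) ≤ (a - b) ^ 2 * (Real.exp a + Real.exp b) / 2 := by
  wlog hab : b ≤ a generalizing a b
  · have := this b a (le_of_not_ge hab)
    linarith
  have h := Real.two_mul_exp_sub_one_le (sub_nonneg.2 hab)
  have hexp : Real.exp a = Real.exp (a - b) * Real.exp b := by rw [← Real.exp_add]; simp
  rw [hexp]
  have := mul_le_mul_of_nonneg_left h (mul_nonneg (sub_nonneg.2 hab) (Real.exp_pos b).le)
  linarith

namespace Matrix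

variable {ι : Type*} [Fintype ι]

lemma exists_spectral_decomposition_exp [DecidableEq ι] {A : Matrix ι ι ℝ} (hA : A.IsSymm) :
    ∃ (U : Matrix ι ι ℝ) (a : ι → ℝ), U * Uᵀ = 1 ∧ Uᵀ * U = 1 ∧ A = U * diagonal a * Uᵀ ∧
      NormedSpace.exp A = U * diagonal (fun i => Real.exp (a i)) * Uᵀ := by
  have hA' : A.IsHermitian := by
    rw [IsHermitian, conjTranspose_eq_transpose_of_trivial, hA.eq]
  let U : Matrix ι ι ℝ := hA'.eigenvectorUnitary
  have hU1 : U * Uᵀ = 1 := by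
    have := (Matrix.mem_unitaryGroup_iff).1 hA'.eigenvectorUnitary.2
    simpa [star_eq_conjTranspose, conjTranspose_eq_transpose_of_trivial] using this
  have hU2 : Uᵀ * U = 1 := mul_eq_one_comm.1 hU1
  have hspec : A = U * diagonal hA'.eigenvalues * Uᵀ := by
    have := hA'.spectral_theorem
    simpa [Unitary.conjStarAlgAut_apply, star_eq_conjTranspose,
      conjTranspose_eq_transpose_of_trivial, Function.comp_def] using this
  refine ⟨U, hA'.eigenvalues, hU1, hU2, hspec, ?_⟩
  have hinv : U⁻¹ = Uᵀ := inv_eq_right_inv hU1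
  have hunit : IsUnit U := IsUnit.of_mul_eq_one _ hU1
  conv_lhs => rw [hspec, ← hinv, exp_conj _ _ hunit, exp_diagonal, hinv]
  congr 3
  funext i
  simp [NormedSpace.exp_def, Real.exp_eq_exp_ℝ, Pi.coe_exp]

lemma posSemidef_affine_exp [DecidableEq ι] {A : Matrix ι ι ℝ} (hA : A.IsSymm) {c₀ c₁ c₂ : ℝ}
    (h : ∀ x, 0 ≤ c₀ + c₁ * x + c₂ * Real.exp x) :
    (c₀ • (1 : Matrix ι ι ℝ) + c₁ • A + c₂ • NormedSpace.exp A).PosSemidef := by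
  obtain ⟨U, a, hU, -, hspec, hexp⟩ := exists_spectral_decomposition_exp hA
  have key : c₀ • (1 : Matrix ι ι ℝ) + c₁ • A + c₂ • NormedSpace.exp A =
      U * diagonal (fun i => c₀ + c₁ * a i + c₂ * Real.exp (a i)) * Uᴴ := by
    have hd : diagonal (fun i => c₀ + c₁ * a i + c₂ * Real.exp (a i)) =
        c₀ • (1 : Matrix ι ι ℝ) + c₁ • diagonal a + c₂ • diagonal (fun i => Real.exp (a i)) := by
      ext i j
      by_cases hij : i = j <;> simp [hij]
    rw [hd, hexp, conjTranspose_eq_transpose_of_trivial]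
    conv_lhs => rw [hspec, ← hU]
    simp only [Matrix.mul_add, Matrix.add_mul, Matrix.mul_smul, Matrix.smul_mul, Matrix.mul_one]
  rw [key]
  exact (PosSemidef.diagonal fun i => h (a i)).mul_mul_conjTranspose_same U

lemma posSemidef_exp [DecidableEq ι] {A : Matrix ι ι ℝ} (hA : A.IsSymm) :
    (NormedSpace.exp A).PosSemidef := by
  simpa using posSemidef_affine_exp hA (c₀ := 0) (c₁ := 0) (c₂ := 1)
    (fun x => by simpa using (Real.exp_pos x).le)

lemma posSemidef_exp_sub_one_sub [DecidableEq ι] {A : Matrix ι ι ℝ} (hA : A.IsSymm) :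
    (NormedSpace.exp A - 1 - A).PosSemidef := by
  have := posSemidef_affine_exp hA (c₀ := -1) (c₁ := -1) (c₂ := 1)
    (fun x => by linarith [Real.add_one_le_exp x])
  convert this using 1
  simp only [one_smul, neg_smul]
  abel

lemma trace_conj_diagonal_mul_conj_diagonal [DecidableEq ι] (U W : Matrix ι ι ℝ) (p r : ι → ℝ) :
    trace ((U * diagonal p * Uᵀ) * (W * diagonal r * Wᵀ)) =
      ∑ i, ∑ j, p i * r j * ((Uᵀ * W) i j) ^ 2 := by
  have : trace ((U * diagonal p * Uᵀ) * (W * diagonal r * Wᵀ)) =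
      trace (diagonal p * (Uᵀ * W) * diagonal r * (Uᵀ * W)ᵀ) := by
    rw [transpose_mul, transpose_transpose]
    rw [show (U * diagonal p * Uᵀ) * (W * diagonal r * Wᵀ) =
      U * (diagonal p * Uᵀ * W * diagonal r * Wᵀ) by simp only [Matrix.mul_assoc], trace_mul_comm]
    simp only [Matrix.mul_assoc]
  rw [this]
  simp only [trace, diag_apply, Matrix.mul_apply (M := _ * diagonal r), mul_diagonal, diagonal_mul,
    transpose_apply]
  refine Finset.sum_congr rfl fun i _ => Finset.sum_congr rfl fun j _ => ?_
  ring

/-- Mean value trace inequality for the exponential. -/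
lemma trace_sub_mul_exp_sub_exp_le [DecidableEq ι] {A B : Matrix ι ι ℝ}
    (hA : A.IsSymm) (hB : B.IsSymm) :
    trace ((A - B) * (NormedSpace.exp A - NormedSpace.exp B)) ≤
      trace ((A - B) * (A - B) * (NormedSpace.exp A + NormedSpace.exp B)) / 2 := by
  obtain ⟨U, a, hU, hU', hAspec, hAexp⟩ := exists_spectral_decomposition_exp hA
  obtain ⟨W, b, hW, hW', hBspec, hBexp⟩ := exists_spectral_decomposition_exp hB
  set w : ι → ι → ℝ := fun i j => ((Uᵀ * W) i j) ^ 2 with hw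
  set F : (ι → ℝ) → Matrix ι ι ℝ := fun p => U * diagonal p * Uᵀ with hF
  set G : (ι → ℝ) → Matrix ι ι ℝ := fun p => W * diagonal p * Wᵀ with hG
  have hFF : ∀ p r, F p * F r = F (fun i => p i * r i) := fun p r => by
    simp only [hF, Matrix.mul_assoc]
    rw [← Matrix.mul_assoc Uᵀ U, hU', Matrix.one_mul, ← Matrix.mul_assoc (diagonal p),
      diagonal_mul_diagonal]
  have hGG : ∀ p r, G p * G r = G (fun i => p i * r i) := fun p r => by
    simp only [hG, Matrix.mul_assoc]
    rw [← Matrix.mul_assoc Wᵀ W, hW', Matrix.one_mul, ← Matrix.mul_assoc (diagonal p),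
      diagonal_mul_diagonal]
  have hFG : ∀ p r, trace (F p * G r) = ∑ i, ∑ j, p i * r j * w i j := fun p r =>
    trace_conj_diagonal_mul_conj_diagonal U W p r
  have hF1 : F 1 = 1 := by simp [hF, hU]
  have hG1 : G 1 = 1 := by simp [hG, hW]
  have hFt : ∀ p, trace (F p) = ∑ i, ∑ j, p i * w i j := fun p => by
    have := hFG p 1
    rw [hG1, Matrix.mul_one] at this
    simpa using this
  have hGt : ∀ p, trace (G p) = ∑ i, ∑ j, p j * w i j := fun p => by
    have := hFG 1 p
    rw [hF1, Matrix.one_mul] at this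
    simpa using this
  have hA' : A = F a := hAspec
  have hB' : B = G b := hBspec
  have e1 : trace ((A - B) * (NormedSpace.exp A - NormedSpace.exp B)) =
      trace (A * NormedSpace.exp A) - trace (A * NormedSpace.exp B)
        - trace (NormedSpace.exp A * B) + trace (B * NormedSpace.exp B) := by
    rw [trace_mul_comm (NormedSpace.exp A) B]
    simp only [Matrix.sub_mul, Matrix.mul_sub, trace_sub]
    ring
  have e2 : trace ((A - B) * (A - B) * (NormedSpace.exp A + NormedSpace.exp B)) =
      trace (A * A * NormedSpace.exp A) + trace (A * A * NormedSpace.exp B)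
       - trace (NormedSpace.exp A * A * B) - trace (A * NormedSpace.exp A * B)
       - trace (A * (B * NormedSpace.exp B)) - trace (A * (NormedSpace.exp B * B))
       + trace (NormedSpace.exp A * (B * B)) + trace (B * B * NormedSpace.exp B) := by
    rw [trace_mul_comm (NormedSpace.exp A) (B * B), Matrix.mul_assoc (NormedSpace.exp A) A B,
      trace_mul_comm (NormedSpace.exp A) (A * B), Matrix.mul_assoc A (NormedSpace.exp A) B,
      trace_mul_comm A (NormedSpace.exp A * B), Matrix.mul_assoc (NormedSpace.exp A),
      trace_mul_comm (NormedSpace.exp A) (B * A), trace_mul_comm A (NormedSpace.exp B * B),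
      Matrix.mul_assoc (NormedSpace.exp B) B A, trace_mul_comm (NormedSpace.exp B) (B * A)]
    simp only [Matrix.sub_mul, Matrix.mul_sub, Matrix.mul_add, trace_sub, trace_add,
      Matrix.mul_assoc]
    ring
  rw [e1, e2, hAexp, hBexp, hA', hB']
  change trace (F a * F _) - trace (F a * G _) - trace (F _ * G b) + trace (G b * G _) ≤
    (trace (F a * F a * F _) + trace (F a * F a * G _) - trace (F _ * F a * G b)
      - trace (F a * F _ * G b) - trace (F a * (G b * G _)) - trace (F a * (G _ * G b))
      + trace (F _ * (G b * G b)) + trace (G b * G b * G _)) / 2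
  simp only [hFF, hGG, hFG, hFt, hGt]
  simp only [← Finset.sum_add_distrib, ← Finset.sum_sub_distrib, Finset.sum_div]
  refine Finset.sum_le_sum fun i _ => Finset.sum_le_sum fun j _ => ?_
  have := mul_le_mul_of_nonneg_right (Real.sub_mul_exp_sub_exp_le (a i) (b j))
    (sq_nonneg ((Uᵀ * W) i j))
  simp only [hw]
  linarith

lemma PosSemidef.trace_diagonal_mul_le [DecidableEq ι] {P : Matrix ι ι ℝ}
    (hP : P.PosSemidef) {s t : ι → ℝ}
    (hst : ∀ i, s i ≤ t i) : trace (diagonal s * P) ≤ trace (diagonal t * P) := by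
  simp only [trace, diag_apply, diagonal_mul]
  exact Finset.sum_le_sum fun i _ => mul_le_mul_of_nonneg_right (hst i) (hP.diag_nonneg)

lemma PosSemidef.trace_mul_self_mul_nonneg {P M : Matrix ι ι ℝ} (hP : P.PosSemidef)
    (hM : M.IsSymm) : 0 ≤ trace (M * M * P) := by
  have h := (hP.mul_mul_conjTranspose_same M).trace_nonneg
  rw [conjTranspose_eq_transpose_of_trivial, hM.eq, trace_mul_comm, ← Matrix.mul_assoc] at h
  exact h

lemma trace_vecMulVec_mul (x : ι → ℝ) (P : Matrix ι ι ℝ) :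
    trace (vecMulVec x x * P) = x ⬝ᵥ P *ᵥ x := by
  rw [trace_mul_comm, mul_vecMulVec, trace_vecMulVec, dotProduct_comm]

lemma PosSemidef.trace_vecMulVec_mul_nonneg {P : Matrix ι ι ℝ} (hP : P.PosSemidef) (x : ι → ℝ) :
    0 ≤ trace (vecMulVec x x * P) := by
  rw [trace_vecMulVec_mul]
  simpa using hP.dotProduct_mulVec_nonneg x

lemma PosSemidef.trace_vecMulVec_mul_self_mul_le {P : Matrix ι ι ℝ} (hP : P.PosSemidef)
    {x : ι → ℝ} {d : ℝ} (hx : x ⬝ᵥ x ≤ d) :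
    trace (vecMulVec x x * vecMulVec x x * P) ≤ d * trace (vecMulVec x x * P) := by
  rw [vecMulVec_mul_vecMulVec, vecMulVec_smul, Matrix.smul_mul, trace_smul, smul_eq_mul]
  exact mul_le_mul_of_nonneg_right hx (hP.trace_vecMulVec_mul_nonneg x)

lemma PosSemidef.dotProduct_mulVec_le_trace [DecidableEq ι] {P : Matrix ι ι ℝ}
    (hP : P.PosSemidef) (u : ι → ℝ) : u ⬝ᵥ P *ᵥ u ≤ (u ⬝ᵥ u) * trace P := by
  rcases eq_or_ne u 0 with rfl | hu
  · simp
  have hs : 0 < u ⬝ᵥ u := by simpa using dotProduct_star_self_pos_iff.2 hu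
  set M : Matrix ι ι ℝ := (u ⬝ᵥ u) • (1 : Matrix ι ι ℝ) - vecMulVec u u with hMdef
  have hM : M.IsSymm := by
    rw [hMdef, IsSymm, transpose_sub, transpose_smul, transpose_one, transpose_vecMulVec]
  have hMM : M * M = (u ⬝ᵥ u) • M := by
    simp only [hMdef, Matrix.sub_mul, Matrix.mul_sub, Matrix.smul_mul, Matrix.mul_smul,
      Matrix.one_mul, Matrix.mul_one, vecMulVec_mul_vecMulVec, vecMulVec_smul, smul_sub]
    abel
  have h := hP.trace_mul_self_mul_nonneg hM
  rw [hMM, Matrix.smul_mul, trace_smul, smul_eq_mul] at h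
  have h' := nonneg_of_mul_nonneg_right h hs
  rw [hMdef, Matrix.sub_mul, Matrix.smul_mul, Matrix.one_mul, trace_sub, trace_smul,
    trace_vecMulVec_mul, smul_eq_mul] at h'
  linarith

/-- A large value of the quadratic form of `A` forces a large trace of `exp A - 1 - A`. -/
lemma exp_sub_one_sub_le_trace [DecidableEq ι] {A : Matrix ι ι ℝ} (hA : A.IsSymm) {u : ι → ℝ}
    {y : ℝ} (hy : 0 ≤ y) (hu : y * (u ⬝ᵥ u) < u ⬝ᵥ A *ᵥ u) :
    Real.exp y - 1 - y ≤ trace (NormedSpace.exp A - 1 - A) := by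
  have hu0 : u ≠ 0 := by rintro rfl; simp at hu
  have hs : 0 < u ⬝ᵥ u := by simpa using dotProduct_star_self_pos_iff.2 hu0
  have htan := posSemidef_affine_exp hA (c₀ := y * Real.exp y - Real.exp y) (c₁ := - Real.exp y)
    (c₂ := 1) (fun x => by
      have h1 := mul_le_mul_of_nonneg_right (Real.add_one_le_exp (x - y)) (Real.exp_pos y).le
      rw [← Real.exp_add, sub_add_cancel] at h1
      linarith)
  have h1 : 0 ≤ u ⬝ᵥ ((y * Real.exp y - Real.exp y) • (1 : Matrix ι ι ℝ) + (-Real.exp y) • A +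
      (1 : ℝ) • NormedSpace.exp A) *ᵥ u := by simpa using htan.dotProduct_mulVec_nonneg u
  simp only [add_mulVec, smul_mulVec, one_mulVec, dotProduct_add, dotProduct_smul,
    smul_eq_mul] at h1
  have h2 := (posSemidef_exp_sub_one_sub hA).dotProduct_mulVec_le_trace u
  simp only [sub_mulVec, one_mulVec, dotProduct_sub] at h2
  have h3 : 0 ≤ (Real.exp y - 1) * (u ⬝ᵥ A *ᵥ u - y * (u ⬝ᵥ u)) :=
    mul_nonneg (by linarith [Real.add_one_le_exp y]) (by linarith)
  refine le_of_mul_le_mul_left ?_ hs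
  linarith

end Matrix

section Integrability

lemma Continuous.integrable_of_ae_mem_isCompact {E : Type*} [TopologicalSpace E]
    [SecondCountableTopology E] [MeasurableSpace E] [BorelSpace E]
    {P : Measure E} [IsFiniteMeasure P] {F : E → ℝ} (hF : Continuous F) {K : Set E}
    (hK : IsCompact K) (h : ∀ᵐ x ∂P, x ∈ K) : Integrable F P := by
  obtain ⟨C, hC⟩ := hK.exists_bound_of_continuousOn hF.continuousOn
  exact Integrable.of_bound hF.aestronglyMeasurable C (h.mono fun x hx => hC x hx)

end Integrability

namespace Matrix

variable {ι : Type*}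

lemma isSymm_vecMulVec_self (x : ι → ℝ) : (vecMulVec x x).IsSymm := by
  rw [IsSymm, transpose_vecMulVec]

/-- The deviation of the rank-one matrix `x xᵀ` from the diagonal matrix with entries `t`. -/
def rankOneDev [DecidableEq ι] (t x : ι → ℝ) : Matrix ι ι ℝ := diagonal t - vecMulVec x x

lemma isSymm_rankOneDev [DecidableEq ι] (t x : ι → ℝ) : (rankOneDev t x).IsSymm :=
  (isSymm_diagonal t).sub (isSymm_vecMulVec_self x)

@[fun_prop]
lemma continuous_rankOneDev [DecidableEq ι] (t : ι → ℝ) : Continuous (rankOneDev t) := by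
  unfold rankOneDev
  exact continuous_const.sub (continuous_id.matrix_vecMulVec continuous_id)

variable [Fintype ι]

lemma isCompact_dotProduct_self_le (d : ℝ) : IsCompact {x : ι → ℝ | x ⬝ᵥ x ≤ d} := by
  refine Metric.isCompact_of_isClosed_isBounded ?_ ?_
  · exact isClosed_le (by fun_prop) continuous_const
  · refine (Metric.isBounded_closedBall (x := (0 : ι → ℝ)) (r := √d)).subset fun x hx => ?_
    rw [mem_closedBall_zero_iff, pi_norm_le_iff_of_nonneg (Real.sqrt_nonneg _)]
    intro i
    rw [Real.norm_eq_abs]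
    refine Real.abs_le_sqrt (le_trans ?_ hx)
    rw [sq]
    exact Finset.single_le_sum (f := fun i => x i * x i) (fun j _ => mul_self_nonneg _)
      (Finset.mem_univ i)

variable [DecidableEq ι]

open scoped Matrix.Norms.Operator in
lemma continuous_exp : Continuous (NormedSpace.exp : Matrix ι ι ℝ → Matrix ι ι ℝ) :=
  NormedSpace.exp_continuous

open scoped Matrix.Norms.Operator in
lemma hasDerivAt_trace_exp_smul (A : Matrix ι ι ℝ) (θ : ℝ) :
    HasDerivAt (fun s : ℝ => trace (NormedSpace.exp (s • A)))
      (trace (A * NormedSpace.exp (θ • A))) θ := by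
  have h := hasDerivAt_exp_smul_const (𝕂 := ℝ) A θ
  have hl :=
    (LinearMap.toContinuousLinearMap (traceLinearMap ι ℝ ℝ)).hasFDerivAt.comp_hasDerivAt θ h
  rw [trace_mul_comm]
  exact hl

variable {ν : Measure (ι → ℝ)} [IsProbabilityMeasure ν] {t : ι → ℝ} {d : ℝ}

lemma integral_trace_vecMulVec_mul (hd : ∀ᵐ x ∂ν, x ⬝ᵥ x ≤ d)
    (hcov : ∀ i j, ∫ x, x i * x j ∂ν = if i = j then t i else 0) (P : Matrix ι ι ℝ) :
    ∫ x, trace (vecMulVec x x * P) ∂ν = trace (diagonal t * P) := by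
  have hint : ∀ F : (ι → ℝ) → ℝ, Continuous F → Integrable F ν := fun F hF =>
    hF.integrable_of_ae_mem_isCompact (isCompact_dotProduct_self_le d) hd
  have h : ∀ x : ι → ℝ, trace (vecMulVec x x * P) = ∑ i, ∑ j, x i * x j * P j i := fun x => by
    simp [trace, Matrix.mul_apply, vecMulVec_apply]
  simp only [h]
  rw [integral_finsetSum _ fun i _ => hint _ (by fun_prop)]
  simp only [trace, diag_apply, diagonal_mul]
  refine Finset.sum_congr rfl fun i _ => ?_
  rw [integral_finsetSum _ fun i _ => hint _ (by fun_prop)]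
  simp [integral_mul_const, hcov]

lemma integral_trace_rankOneDev_mul (hd : ∀ᵐ x ∂ν, x ⬝ᵥ x ≤ d)
    (hcov : ∀ i j, ∫ x, x i * x j ∂ν = if i = j then t i else 0) (P : Matrix ι ι ℝ) :
    ∫ x, trace (rankOneDev t x * P) ∂ν = 0 := by
  have hint : ∀ F : (ι → ℝ) → ℝ, Continuous F → Integrable F ν := fun F hF =>
    hF.integrable_of_ae_mem_isCompact (isCompact_dotProduct_self_le d) hd
  simp only [rankOneDev, Matrix.sub_mul, trace_sub]
  rw [integral_sub (integrable_const _) (hint _ (by fun_prop)),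
    integral_trace_vecMulVec_mul hd hcov]
  simp

lemma integral_trace_sq_sub_le (hd : ∀ᵐ x ∂ν, x ⬝ᵥ x ≤ d)
    (hcov : ∀ i j, ∫ x, x i * x j ∂ν = if i = j then t i else 0)
    (ht0 : ∀ i, 0 ≤ t i) (ht1 : ∀ i, t i ≤ 1) {a : ℝ} (ha : 0 < a)
    {P : Matrix ι ι ℝ} (hP : P.PosSemidef) {x : ι → ℝ} (hx : x ⬝ᵥ x ≤ d) :
    ∫ y, trace ((rankOneDev t x - rankOneDev t y) * (rankOneDev t x - rankOneDev t y) * P) ∂ν ≤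
      (1 + a) * d * trace (vecMulVec x x * P) + (d + 1 / a) * trace (diagonal t * P) := by
  have hint : ∀ F : (ι → ℝ) → ℝ, Continuous F → Integrable F ν := fun F hF =>
    hF.integrable_of_ae_mem_isCompact (isCompact_dotProduct_self_le d) hd
  set Y := vecMulVec x x with hY
  set T := diagonal t with hT
  have hexp : ∀ y : ι → ℝ, y ⬝ᵥ y ≤ d →
      trace ((rankOneDev t x - rankOneDev t y) * (rankOneDev t x - rankOneDev t y) * P) ≤
      trace (Y * Y * P) - trace (vecMulVec y y * (P * Y)) - trace (vecMulVec y y * (Y * P))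
        + d * trace (vecMulVec y y * P) := fun y hy => by
    have h1 := hP.trace_vecMulVec_mul_self_mul_le hy
    have h2 : rankOneDev t x - rankOneDev t y = vecMulVec y y - Y := by
      simp [rankOneDev, hY]
    have h3 : trace (vecMulVec y y * (P * Y)) = trace (Y * vecMulVec y y * P) := by
      rw [← Matrix.mul_assoc, trace_mul_comm, Matrix.mul_assoc]
    rw [h2, h3]
    simp only [Matrix.sub_mul, Matrix.mul_sub, trace_sub, Matrix.mul_assoc] at h1 ⊢
    linarith
  have hle := integral_mono_ae (hint _ (by fun_prop)) (hint _ (by fun_prop)) (hd.mono hexp)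
  refine hle.trans ?_
  rw [integral_add (hint _ (by fun_prop)) (hint _ (by fun_prop)),
    integral_sub (hint _ (by fun_prop)) (hint _ (by fun_prop)),
    integral_sub (hint _ (by fun_prop)) (hint _ (by fun_prop)), integral_const_mul]
  simp only [integral_trace_vecMulVec_mul hd hcov, integral_const, probReal_univ, one_smul]
  have h4 : 0 ≤ trace ((a • Y + T) * (a • Y + T) * P) :=
    hP.trace_mul_self_mul_nonneg (((isSymm_vecMulVec_self x).smul a).add (isSymm_diagonal t))
  have h5 : trace ((a • Y + T) * (a • Y + T) * P) = a * a * trace (Y * Y * P)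
      + a * trace (T * (P * Y)) + a * trace (T * (Y * P)) + trace (T * T * P) := by
    have h3 : trace (T * (P * Y)) = trace (Y * T * P) := by
      rw [← Matrix.mul_assoc, trace_mul_comm, Matrix.mul_assoc]
    rw [h3]
    simp only [Matrix.add_mul, Matrix.mul_add, trace_add, Matrix.mul_assoc, Matrix.smul_mul,
      Matrix.mul_smul, trace_smul, smul_eq_mul]
    ring
  have h6 : trace (T * T * P) ≤ trace (T * P) := by
    rw [hT, diagonal_mul_diagonal]
    exact hP.trace_diagonal_mul_le fun i => mul_le_of_le_one_left (ht0 i) (ht1 i)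
  have h7 := hP.trace_vecMulVec_mul_self_mul_le hx
  rw [← hY] at h7
  have h8 : 0 ≤ a * trace (Y * Y * P) + trace (T * (P * Y)) + trace (T * (Y * P))
      + 1 / a * trace (T * P) := by
    have : 0 ≤ (1 / a) * (a * a * trace (Y * Y * P)
      + a * trace (T * (P * Y)) + a * trace (T * (Y * P)) + trace (T * P)) :=
      mul_nonneg (by positivity) (by linarith)
    convert this using 1
    field_simp
  have h9 := mul_le_mul_of_nonneg_left h7 (show 0 ≤ 1 + a by linarith)
  linarith

lemma integral_trace_rankOneDev_mul_exp_le (hd : ∀ᵐ x ∂ν, x ⬝ᵥ x ≤ d)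
    (hcov : ∀ i j, ∫ x, x i * x j ∂ν = if i = j then t i else 0)
    (ht0 : ∀ i, 0 ≤ t i) (ht1 : ∀ i, t i ≤ 1) {a : ℝ} (ha : 0 < a)
    {B : Matrix ι ι ℝ} (hB : B.IsSymm) {θ : ℝ} (hθ : 0 < θ) :
    ∫ x, trace (rankOneDev t x * NormedSpace.exp (θ • (rankOneDev t x + B))) ∂ν ≤
      ∫ x, θ / 2 * ((1 + a) * d *
          trace (vecMulVec x x * NormedSpace.exp (θ • (rankOneDev t x + B)))
        + (d + 1 / a) * trace (diagonal t * NormedSpace.exp (θ • (rankOneDev t x + B)))) ∂ν := by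
  have hint : ∀ F : (ι → ℝ) → ℝ, Continuous F → Integrable F ν := fun F hF =>
    hF.integrable_of_ae_mem_isCompact (isCompact_dotProduct_self_le d) hd
  have hint2 : ∀ F : (ι → ℝ) × (ι → ℝ) → ℝ, Continuous F → Integrable F (ν.prod ν) := fun F hF => by
    refine hF.integrable_of_ae_mem_isCompact
      ((isCompact_dotProduct_self_le d).prod (isCompact_dotProduct_self_le d)) ?_
    filter_upwards [Measure.quasiMeasurePreserving_fst.ae hd,
      Measure.quasiMeasurePreserving_snd.ae hd] with p h1 h2 using ⟨h1, h2⟩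
  set E : (ι → ℝ) → Matrix ι ι ℝ := fun x => NormedSpace.exp (θ • (rankOneDev t x + B)) with hE
  have hsymm : ∀ x, (θ • (rankOneDev t x + B)).IsSymm := fun x =>
    ((isSymm_rankOneDev t x).add hB).smul θ
  have hEpos : ∀ x, (E x).PosSemidef := fun x => posSemidef_exp (hsymm x)
  have hEcont : Continuous E := continuous_exp.comp (by fun_prop)
  set K : (ι → ℝ) × (ι → ℝ) → ℝ := fun p =>
    trace ((rankOneDev t p.1 - rankOneDev t p.2) * (rankOneDev t p.1 - rankOneDev t p.2) * E p.1)
    with hK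
  have hKcont : Continuous K := by fun_prop
  set b : (ι → ℝ) × (ι → ℝ) → ℝ := fun p => trace (rankOneDev t p.2 * E p.1) with hb
  set c : (ι → ℝ) → ℝ := fun x => trace (rankOneDev t x * E x) with hc
  have hbcont : Continuous b := by fun_prop
  have hccont : Continuous c := by fun_prop
  have hpt : ∀ p : (ι → ℝ) × (ι → ℝ), c p.1 + c p.2 - b p - b p.swap ≤
      θ / 2 * (K p + K p.swap) := fun p => by
    have h := trace_sub_mul_exp_sub_exp_le (hsymm p.1) (hsymm p.2)
    have hsub : θ • (rankOneDev t p.1 + B) - θ • (rankOneDev t p.2 + B) =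
        θ • (rankOneDev t p.1 - rankOneDev t p.2) := by
      rw [← smul_sub]; congr 1; abel
    rw [hsub] at h
    have h1 : θ * (c p.1 + c p.2 - b p - b p.swap) ≤ θ * (θ / 2 * (K p + K p.swap)) := by
      have hKs : K p.swap = trace ((rankOneDev t p.1 - rankOneDev t p.2) *
          (rankOneDev t p.1 - rankOneDev t p.2) * E p.2) := by
        simp only [hK, Prod.fst_swap, Prod.snd_swap]
        rw [← neg_sub (rankOneDev t p.1), neg_mul_neg]
      rw [hKs]
      simp only [hc, hb, hK, Prod.fst_swap, Prod.snd_swap]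
      simp only [Matrix.smul_mul, Matrix.mul_smul, trace_smul, smul_eq_mul, Matrix.mul_add,
        trace_add] at h
      have h2 : trace ((rankOneDev t p.1 - rankOneDev t p.2) * (E p.1 - E p.2)) =
          trace (rankOneDev t p.1 * E p.1) + trace (rankOneDev t p.2 * E p.2)
          - trace (rankOneDev t p.2 * E p.1) - trace (rankOneDev t p.1 * E p.2) := by
        simp only [Matrix.sub_mul, Matrix.mul_sub, trace_sub]
        ring
      rw [← h2]
      linarith
    exact le_of_mul_le_mul_left h1 hθ
  have hswap : ∀ F : (ι → ℝ) × (ι → ℝ) → ℝ, ∫ p, F p.swap ∂(ν.prod ν) = ∫ p, F p ∂(ν.prod ν) :=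
    fun F => integral_prod_swap F
  have hb0 : ∫ p, b p ∂(ν.prod ν) = 0 := by
    rw [integral_prod _ (hint2 _ hbcont)]
    simp only [hb, integral_trace_rankOneDev_mul hd hcov, integral_zero]
  have hc1 : ∫ p, c p.1 ∂(ν.prod ν) = ∫ x, c x ∂ν := by
    rw [integral_prod _ (hint2 _ (by fun_prop))]
    simp
  have hc2 : ∫ p, c p.2 ∂(ν.prod ν) = ∫ x, c x ∂ν := by
    rw [integral_prod _ (hint2 _ (by fun_prop))]
    simp
  have hmain := integral_mono (hint2 _ (by fun_prop)) (hint2 _ (by fun_prop)) hpt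
  rw [integral_sub (hint2 _ (by fun_prop)) (hint2 _ (by fun_prop)),
    integral_sub (hint2 _ (by fun_prop)) (hint2 _ (by fun_prop)),
    integral_add (hint2 _ (by fun_prop)) (hint2 _ (by fun_prop)), integral_const_mul,
    integral_add (hint2 _ (by fun_prop)) (hint2 _ (by fun_prop)), hswap, hswap, hb0, hc1, hc2,
    integral_prod _ (hint2 _ hKcont)] at hmain
  have hKle : ∫ x, ∫ y, K (x, y) ∂ν ∂ν ≤ ∫ x, ((1 + a) * d * trace (vecMulVec x x * E x)
      + (d + 1 / a) * trace (diagonal t * E x)) ∂ν :=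
    integral_mono_ae (hint2 _ hKcont).integral_prod_left (hint _ (by fun_prop))
      (hd.mono fun x hx => integral_trace_sq_sub_le hd hcov ht0 ht1 ha (hEpos x) hx)
  rw [integral_const_mul]
  have := mul_le_mul_of_nonneg_left hKle (show 0 ≤ θ / 2 by positivity)
  linarith

end Matrix

namespace Matrix

variable {ι : Type*} {n : ℕ}

/-- The sum of the deviations of the rank-one matrices built from a family of vectors. -/
def sumDev [DecidableEq ι] (t : ι → ℝ) (xs : Fin n → ι → ℝ) : Matrix ι ι ℝ :=
  ∑ i, rankOneDev t (xs i)

lemma isSymm_sumDev [DecidableEq ι] (t : ι → ℝ) (xs : Fin n → ι → ℝ) : (sumDev t xs).IsSymm := by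
  rw [IsSymm, sumDev, transpose_sum]
  exact Finset.sum_congr rfl fun i _ => isSymm_rankOneDev t (xs i)

@[fun_prop]
lemma continuous_sumDev [DecidableEq ι] (t : ι → ℝ) : Continuous (sumDev (n := n) t) := by
  unfold sumDev
  fun_prop

lemma sum_vecMulVec_eq [DecidableEq ι] (t : ι → ℝ) (xs : Fin n → ι → ℝ) :
    ∑ i, vecMulVec (xs i) (xs i) = (n : ℝ) • diagonal t - sumDev t xs := by
  simp only [sumDev, rankOneDev, Finset.sum_sub_distrib, Finset.sum_const, Finset.card_univ,
    Fintype.card_fin, sub_sub_cancel, ← Nat.cast_smul_eq_nsmul ℝ]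

variable [Fintype ι]

lemma isCompact_pi_dotProduct_self_le (d : ℝ) :
    IsCompact {xs : Fin n → ι → ℝ | ∀ i, xs i ⬝ᵥ xs i ≤ d} := by
  simpa [Set.pi] using isCompact_univ_pi fun _ : Fin n => isCompact_dotProduct_self_le (ι := ι) d

lemma ae_pi_dotProduct_self_le {ν : Measure (ι → ℝ)} [IsProbabilityMeasure ν] {d : ℝ}
    (hd : ∀ᵐ x ∂ν, x ⬝ᵥ x ≤ d) :
    ∀ᵐ xs ∂(Measure.pi fun _ : Fin n => ν), ∀ i, xs i ⬝ᵥ xs i ≤ d :=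
  ae_all_iff.2 fun i => (Measure.quasiMeasurePreserving_eval (fun _ : Fin n => ν) i).ae hd

lemma integrable_pi_of_continuous {ν : Measure (ι → ℝ)} [IsProbabilityMeasure ν] {d : ℝ}
    (hd : ∀ᵐ x ∂ν, x ⬝ᵥ x ≤ d) {F : (Fin n → ι → ℝ) → ℝ}
    (hF : Continuous F) : Integrable F (Measure.pi fun _ : Fin n => ν) :=
  hF.integrable_of_ae_mem_isCompact (isCompact_pi_dotProduct_self_le d)
    (ae_pi_dotProduct_self_le hd)

variable [DecidableEq ι]

@[fun_prop]
lemma continuous_exp_smul_sumDev (t : ι → ℝ) :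
    Continuous fun p : ℝ × (Fin n → ι → ℝ) => NormedSpace.exp (p.1 • sumDev t p.2) :=
  continuous_exp.comp (by fun_prop)

lemma continuous_exp_smul_sumDev_right (t : ι → ℝ) (θ : ℝ) :
    Continuous fun xs : Fin n → ι → ℝ => NormedSpace.exp (θ • sumDev t xs) :=
  continuous_exp.comp (by fun_prop)

variable {ν : Measure (ι → ℝ)} [IsProbabilityMeasure ν] {t : ι → ℝ} {d : ℝ}

lemma integral_trace_eval_mul_exp_sumDev_le (hd : ∀ᵐ x ∂ν, x ⬝ᵥ x ≤ d)
    (hcov : ∀ i j, ∫ x, x i * x j ∂ν = if i = j then t i else 0)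
    (ht0 : ∀ i, 0 ≤ t i) (ht1 : ∀ i, t i ≤ 1) {a : ℝ} (ha : 0 < a) {θ : ℝ} (hθ : 0 < θ)
    (i : Fin n) :
    ∫ xs, trace (rankOneDev t (xs i) * NormedSpace.exp (θ • sumDev t xs))
        ∂(Measure.pi fun _ : Fin n => ν) ≤
      ∫ xs, θ / 2 * ((1 + a) * d *
          trace (vecMulVec (xs i) (xs i) * NormedSpace.exp (θ • sumDev t xs))
        + (d + 1 / a) * trace (diagonal t * NormedSpace.exp (θ • sumDev t xs)))
        ∂(Measure.pi fun _ : Fin n => ν) := by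
  obtain _ | k := n
  · exact i.elim0
  have hE := continuous_exp_smul_sumDev_right (n := k + 1) t θ
  have hmp := (measurePreserving_piFinSuccAbove (fun _ : Fin (k + 1) => ν) i).symm
  have htransfer : ∀ F : (Fin (k + 1) → ι → ℝ) → ℝ, Continuous F →
      Integrable (fun p : (ι → ℝ) × (Fin k → ι → ℝ) => F (i.insertNth p.1 p.2))
        (ν.prod (Measure.pi fun _ : Fin k => ν)) ∧
      ∫ xs, F xs ∂(Measure.pi fun _ : Fin (k + 1) => ν) =
        ∫ w, ∫ x, F (i.insertNth x w) ∂ν ∂(Measure.pi fun _ : Fin k => ν) := fun F hF => by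
    have hint : Integrable (fun p : (ι → ℝ) × (Fin k → ι → ℝ) => F (i.insertNth p.1 p.2))
        (ν.prod (Measure.pi fun _ : Fin k => ν)) :=
      hmp.integrable_comp_of_integrable (integrable_pi_of_continuous hd hF)
    refine ⟨hint, ?_⟩
    rw [← hmp.integral_comp' F]
    exact integral_prod_symm _ hint
  have hF1 : Continuous fun xs : Fin (k + 1) → ι → ℝ =>
      trace (rankOneDev t (xs i) * NormedSpace.exp (θ • sumDev t xs)) := by fun_prop
  have hF2 : Continuous fun xs : Fin (k + 1) → ι → ℝ => θ / 2 * ((1 + a) * d *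
      trace (vecMulVec (xs i) (xs i) * NormedSpace.exp (θ • sumDev t xs))
        + (d + 1 / a) * trace (diagonal t * NormedSpace.exp (θ • sumDev t xs))) := by fun_prop
  rw [(htransfer _ hF1).2, (htransfer _ hF2).2]
  refine integral_mono (htransfer _ hF1).1.integral_prod_right
    (htransfer _ hF2).1.integral_prod_right fun w => ?_
  have hsum : ∀ x, sumDev t (i.insertNth x w : Fin (k + 1) → ι → ℝ) =
      rankOneDev t x + sumDev t w := fun x => by
    simp [sumDev, Fin.sum_univ_succAbove _ i]
  simp only [hsum, Fin.insertNth_apply_same]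
  exact integral_trace_rankOneDev_mul_exp_le hd hcov ht0 ht1 ha (isSymm_sumDev t w) hθ

lemma integral_trace_sumDev_mul (hd : ∀ᵐ x ∂ν, x ⬝ᵥ x ≤ d)
    (hcov : ∀ i j, ∫ x, x i * x j ∂ν = if i = j then t i else 0) (Q : Matrix ι ι ℝ) :
    ∫ xs, trace (sumDev t xs * Q) ∂(Measure.pi fun _ : Fin n => ν) = 0 := by
  simp only [sumDev, Matrix.sum_mul, trace_sum]
  rw [integral_finsetSum _ fun i _ => integrable_pi_of_continuous hd (by fun_prop)]
  refine Finset.sum_eq_zero fun i _ => ?_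
  have hF : Continuous fun x : ι → ℝ => trace (rankOneDev t x * Q) := by fun_prop
  have hmp := measurePreserving_eval (fun _ : Fin n => ν) i
  rw [← integral_trace_rankOneDev_mul hd hcov Q]
  exact hmp.hasLaw.integral_comp hF.aestronglyMeasurable

lemma integral_trace_sumDev_mul_exp_le (hd : ∀ᵐ x ∂ν, x ⬝ᵥ x ≤ d)
    (hcov : ∀ i j, ∫ x, x i * x j ∂ν = if i = j then t i else 0)
    (ht0 : ∀ i, 0 ≤ t i) (ht1 : ∀ i, t i ≤ 1) {a : ℝ} (ha : 0 < a) {θ : ℝ} (hθ : 0 < θ) :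
    ∫ xs, trace (sumDev t xs * NormedSpace.exp (θ • sumDev t xs))
        ∂(Measure.pi fun _ : Fin n => ν) ≤
      θ / 2 * (((1 + a) * d + (d + 1 / a)) * n *
        ∫ xs, trace (diagonal t * NormedSpace.exp (θ • sumDev t xs))
          ∂(Measure.pi fun _ : Fin n => ν)
        - (1 + a) * d * ∫ xs, trace (sumDev t xs * NormedSpace.exp (θ • sumDev t xs))
          ∂(Measure.pi fun _ : Fin n => ν)) := by
  have hE := continuous_exp_smul_sumDev_right (n := n) t θ
  have hint : ∀ F : (Fin n → ι → ℝ) → ℝ, Continuous F →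
      Integrable F (Measure.pi fun _ : Fin n => ν) := fun F => integrable_pi_of_continuous hd
  have h1 : ∫ xs, trace (sumDev t xs * NormedSpace.exp (θ • sumDev t xs))
        ∂(Measure.pi fun _ : Fin n => ν) = ∑ i, ∫ xs, trace (rankOneDev t (xs i) *
          NormedSpace.exp (θ • sumDev t xs)) ∂(Measure.pi fun _ : Fin n => ν) := by
    rw [← integral_finsetSum _ fun i _ => hint _ (by fun_prop)]
    congr 1
    funext xs
    rw [← trace_sum, ← Matrix.sum_mul, ← sumDev]
  have h2 := Finset.sum_le_sum fun i (_ : i ∈ Finset.univ) =>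
    integral_trace_eval_mul_exp_sumDev_le (n := n) hd hcov ht0 ht1 ha hθ i
  rw [← h1, ← integral_finsetSum _ fun i _ => hint _ (by fun_prop)] at h2
  refine h2.trans_eq ?_
  rw [← integral_const_mul, ← integral_const_mul,
    ← integral_sub (hint _ (by fun_prop)) (hint _ (by fun_prop)), ← integral_const_mul]
  congr 1
  funext xs
  rw [← Finset.mul_sum, Finset.sum_add_distrib, ← Finset.mul_sum, ← trace_sum, ← Matrix.sum_mul,
    sum_vecMulVec_eq t]
  simp only [Matrix.sub_mul, Matrix.smul_mul, trace_sub, trace_smul, smul_eq_mul, Finset.sum_const,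
    Finset.card_univ, Fintype.card_fin, nsmul_eq_mul]
  ring

lemma integral_trace_exp_sub_one_sub (hd : ∀ᵐ x ∂ν, x ⬝ᵥ x ≤ d)
    (hcov : ∀ i j, ∫ x, x i * x j ∂ν = if i = j then t i else 0) (θ : ℝ) :
    ∫ xs, trace (NormedSpace.exp (θ • sumDev t xs) - 1 - θ • sumDev t xs)
        ∂(Measure.pi fun _ : Fin n => ν) =
      ∫ xs, trace (NormedSpace.exp (θ • sumDev t xs)) ∂(Measure.pi fun _ : Fin n => ν)
        - Fintype.card ι := by
  have hE := continuous_exp_smul_sumDev_right (n := n) t θ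
  have hint : ∀ F : (Fin n → ι → ℝ) → ℝ, Continuous F →
      Integrable F (Measure.pi fun _ : Fin n => ν) := fun F => integrable_pi_of_continuous hd
  have h0 := integral_trace_sumDev_mul (n := n) hd hcov 1
  simp only [Matrix.mul_one] at h0
  simp only [trace_sub, trace_smul, trace_one, smul_eq_mul]
  rw [integral_sub (hint _ (by fun_prop)) (hint _ (by fun_prop)),
    integral_sub (hint _ (by fun_prop)) (hint _ (by fun_prop)), integral_const_mul, h0]
  simp

lemma integral_trace_diagonal_mul_exp_le (hd : ∀ᵐ x ∂ν, x ⬝ᵥ x ≤ d)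
    (hcov : ∀ i j, ∫ x, x i * x j ∂ν = if i = j then t i else 0)
    (ht1 : ∀ i, t i ≤ 1) (htd : ∑ i, t i ≤ d) (θ : ℝ) :
    ∫ xs, trace (diagonal t * NormedSpace.exp (θ • sumDev t xs))
        ∂(Measure.pi fun _ : Fin n => ν) ≤
      d + (∫ xs, trace (NormedSpace.exp (θ • sumDev t xs)) ∂(Measure.pi fun _ : Fin n => ν)
        - Fintype.card ι) := by
  have hE := continuous_exp_smul_sumDev_right (n := n) t θ
  have hint : ∀ F : (Fin n → ι → ℝ) → ℝ, Continuous F →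
      Integrable F (Measure.pi fun _ : Fin n => ν) := fun F => integrable_pi_of_continuous hd
  rw [← integral_trace_exp_sub_one_sub hd hcov]
  have hpt : ∀ xs : Fin n → ι → ℝ, trace (diagonal t * NormedSpace.exp (θ • sumDev t xs)) ≤
      d + θ * trace (sumDev t xs * diagonal t)
        + trace (NormedSpace.exp (θ • sumDev t xs) - 1 - θ • sumDev t xs) := fun xs => by
    have h := (posSemidef_exp_sub_one_sub ((isSymm_sumDev t xs).smul θ)).trace_diagonal_mul_le ht1
    rw [show diagonal (fun _ : ι => (1 : ℝ)) = 1 from diagonal_one, Matrix.one_mul] at h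
    simp only [Matrix.mul_sub, Matrix.mul_one, Matrix.mul_smul, trace_sub, trace_smul,
      trace_diagonal, smul_eq_mul] at h ⊢
    rw [trace_mul_comm (sumDev t xs)]
    linarith
  refine (integral_mono (hint _ (by fun_prop)) (hint _ (by fun_prop)) hpt).trans_eq ?_
  rw [integral_add (hint _ (by fun_prop)) (hint _ (by fun_prop)),
    integral_add (hint _ (by fun_prop)) (hint _ (by fun_prop)), integral_const_mul,
    integral_trace_sumDev_mul hd hcov]
  simp

lemma hasDerivAt_integral_trace_exp (hd : ∀ᵐ x ∂ν, x ⬝ᵥ x ≤ d) (θ : ℝ) :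
    HasDerivAt (fun s : ℝ => ∫ xs, trace (NormedSpace.exp (s • sumDev t xs))
        ∂(Measure.pi fun _ : Fin n => ν))
      (∫ xs, trace (sumDev t xs * NormedSpace.exp (θ • sumDev t xs))
        ∂(Measure.pi fun _ : Fin n => ν)) θ := by
  have hE := fun θ => continuous_exp_smul_sumDev_right (n := n) t θ
  have hcont : Continuous fun p : ℝ × (Fin n → ι → ℝ) =>
      trace (sumDev t p.2 * NormedSpace.exp (p.1 • sumDev t p.2)) := by fun_prop
  obtain ⟨C, hC⟩ := ((isCompact_closedBall θ 1).prod
    (isCompact_pi_dotProduct_self_le (ι := ι) (n := n) d)).exists_bound_of_continuousOn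
      hcont.continuousOn
  refine (hasDerivAt_integral_of_dominated_loc_of_deriv_le (bound := fun _ => C)
    (F' := fun s xs => trace (sumDev t xs * NormedSpace.exp (s • sumDev t xs)))
    (Metric.closedBall_mem_nhds θ one_pos) (.of_forall fun s => ?_)
    (integrable_pi_of_continuous hd (by fun_prop)) ?_ ?_ (integrable_const _)
    (.of_forall fun xs s _ => hasDerivAt_trace_exp_smul _ s)).2
  · exact (hE s).matrix_trace.aestronglyMeasurable
  · exact (integrable_pi_of_continuous hd (by fun_prop)).aestronglyMeasurable
  · filter_upwards [ae_pi_dotProduct_self_le hd] with xs hxs s hs using hC (s, xs) ⟨hs, hxs⟩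

lemma integral_trace_exp_sub_card_le (hd : ∀ᵐ x ∂ν, x ⬝ᵥ x ≤ d) (hd0 : 0 ≤ d)
    (hcov : ∀ i j, ∫ x, x i * x j ∂ν = if i = j then t i else 0)
    (ht0 : ∀ i, 0 ≤ t i) (ht1 : ∀ i, t i ≤ 1) (htd : ∑ i, t i ≤ d) {a c : ℝ} (ha : 0 < a)
    (hc : ((1 + a) * d + (d + 1 / a)) * n / 2 ≤ c) {θ : ℝ} (hθ : 0 ≤ θ) :
    ∫ xs, trace (NormedSpace.exp (θ • sumDev t xs)) ∂(Measure.pi fun _ : Fin n => ν)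
        - Fintype.card ι ≤ d * Real.exp (c / 2 * θ ^ 2) := by
  set m : ℝ → ℝ := fun s => ∫ xs, trace (NormedSpace.exp (s • sumDev t xs))
    ∂(Measure.pi fun _ : Fin n => ν) with hm
  set m' : ℝ → ℝ := fun s => ∫ xs, trace (sumDev t xs * NormedSpace.exp (s • sumDev t xs))
    ∂(Measure.pi fun _ : Fin n => ν) with hm'
  have hderiv : ∀ s, HasDerivAt m (m' s) s := fun s => hasDerivAt_integral_trace_exp hd s
  have hnonneg : ∀ s, 0 ≤ m s - Fintype.card ι := fun s => by
    rw [hm, ← integral_trace_exp_sub_one_sub hd hcov]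
    exact integral_nonneg fun xs =>
      (posSemidef_exp_sub_one_sub ((isSymm_sumDev t xs).smul s)).trace_nonneg
  have hm'le : ∀ s, 0 < s → m' s ≤ c * s * (d + (m s - Fintype.card ι)) := fun s hs => by
    have hc0 : 0 ≤ ((1 + a) * d + (d + 1 / a)) * n / 2 := by positivity
    rcases le_or_gt (m' s) 0 with h | h
    · refine h.trans (mul_nonneg (mul_nonneg (hc0.trans hc) hs.le) (add_nonneg hd0 (hnonneg s)))
    · have h1 := integral_trace_sumDev_mul_exp_le (n := n) hd hcov ht0 ht1 ha hs
      have h2 := integral_trace_diagonal_mul_exp_le (n := n) hd hcov ht1 htd s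
      change _ ≤ d + (m s - Fintype.card ι) at h2
      change m' s ≤ s / 2 * (_ - (1 + a) * d * m' s) at h1
      have h3 : 0 ≤ s / 2 * ((1 + a) * d * m' s) := by positivity
      have h4 := mul_le_mul_of_nonneg_left h2 (mul_nonneg hs.le hc0)
      have h5 := mul_le_mul_of_nonneg_right (mul_le_mul_of_nonneg_left hc hs.le)
        (add_nonneg hd0 (hnonneg s))
      linarith
  let H : ℝ → ℝ := fun s => (d + (m s - Fintype.card ι)) * Real.exp (-(c / 2 * s ^ 2))
  have hH : ∀ s, HasDerivAt H (m' s * Real.exp (-(c / 2 * s ^ 2)) +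
      (d + (m s - Fintype.card ι)) * (Real.exp (-(c / 2 * s ^ 2)) * -(c * s))) s := fun s => by
    have h1 : HasDerivAt (fun s : ℝ => -(c / 2 * s ^ 2)) (-(c * s)) s := by
      refine ((hasDerivAt_pow 2 s).const_mul (c / 2)).neg.congr_deriv ?_
      push_cast
      ring
    exact (((hderiv s).sub_const _).const_add d).mul h1.exp
  have hanti : AntitoneOn H (Set.Ici 0) := by
    refine antitoneOn_of_deriv_nonpos (convex_Ici 0)
      (fun x _ => (hH x).continuousAt.continuousWithinAt)
      (fun x _ => (hH x).differentiableAt.differentiableWithinAt) fun s hs => ?_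
    rw [interior_Ici] at hs
    rw [(hH s).deriv]
    have := mul_le_mul_of_nonneg_right (hm'le s hs) (Real.exp_pos (-(c / 2 * s ^ 2))).le
    linarith
  have h0 := hanti Set.self_mem_Ici (show θ ∈ Set.Ici 0 from hθ) hθ
  have hm0 : m 0 = Fintype.card ι := by simp [hm]
  simp only [H, hm0, Real.exp_neg] at h0
  rw [← div_eq_mul_inv, div_le_iff₀ (Real.exp_pos _)] at h0
  simp at h0
  linarith

/-- Intrinsic-dimension lower-tail bound for sums of independent rank-one matrices. -/
lemma measureReal_exists_lt_quadratic_le (hd : ∀ᵐ x ∂ν, x ⬝ᵥ x ≤ d) (hd0 : 0 < d)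
    (hcov : ∀ i j, ∫ x, x i * x j ∂ν = if i = j then t i else 0)
    (ht0 : ∀ i, 0 ≤ t i) (ht1 : ∀ i, t i ≤ 1) (htd : ∑ i, t i ≤ d)
    {δ : ℝ} (hδ : δ ∈ Set.Ioo (0 : ℝ) 1) (hn : 0 < n)
    (hnL : 5 * (d + 1) * Real.log (16 * n / (5 * δ)) ≤ n) :
    (Measure.pi fun _ : Fin n => ν).real
      {xs | ∃ u : ι → ℝ, 3 * n / 4 * (u ⬝ᵥ u) < u ⬝ᵥ sumDev t xs *ᵥ u} ≤ δ := by
  obtain ⟨hδ0, hδ1⟩ := hδ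
  have hn1 : (1 : ℝ) ≤ n := by exact_mod_cast hn
  set L := Real.log (16 * n / (5 * δ)) with hL
  have harg : 16 / 5 ≤ 16 * n / (5 * δ) := by
    rw [div_le_div_iff₀ (by norm_num) (by positivity)]
    nlinarith
  have hL1 : 1 ≤ L := by
    rw [hL, Real.le_log_iff_exp_le (by positivity)]
    linarith [Real.exp_one_lt_d9]
  have hexpL : Real.exp (-L) = 5 * δ / (16 * n) := by
    rw [Real.exp_neg, hL, Real.exp_log (by positivity), inv_div]
  have hdn : 5 * (d + 1) ≤ n := le_trans (le_mul_of_one_le_right (by positivity) hL1) hnL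
  set θ : ℝ := 3 / (5 * (d + 1)) with hθ
  have hθ0 : 0 < θ := by positivity
  set r : ℝ := n / (d + 1) with hr
  have hrL : 5 * L ≤ r := by
    rw [hr, le_div_iff₀ (by positivity)]
    linarith
  set y : ℝ := 3 * n / 4 * θ with hy
  have hyr : y = 9 / 20 * r := by rw [hy, hr, hθ]; field_simp; norm_num
  have hy2 : 2 ≤ y := by rw [hyr]; linarith
  have hs := Real.sq_sqrt hd0.le
  have hs0 : 0 < √d := Real.sqrt_pos.2 hd0
  have hmgf := integral_trace_exp_sub_card_le (n := n) (c := 5 / 4 * (d + 1) * n) (a := 1 / √d)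
    hd hd0.le hcov ht0 ht1 htd (by positivity) (by
      have h1 : (1 + 1 / √d) * d + (d + 1 / (1 / √d)) = 2 * d + 2 * √d := by
        rw [one_div_one_div, add_mul, one_mul, one_div_mul_eq_div, Real.div_sqrt]
        ring
      rw [h1]
      have h2 : 2 * d + 2 * √d ≤ 5 / 2 * (d + 1) := by nlinarith [sq_nonneg (√d - 2)]
      have := mul_le_mul_of_nonneg_right h2 (show (0 : ℝ) ≤ n / 2 by positivity)
      linarith) hθ0.le
  have hexpo : 5 / 4 * (d + 1) * n / 2 * θ ^ 2 = y / 2 := by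
    rw [hyr, hθ, hr]; field_simp; norm_num
  rw [hexpo, ← integral_trace_exp_sub_one_sub hd hcov] at hmgf
  have hE := continuous_exp_smul_sumDev_right (n := n) t θ
  have hmarkov := mul_meas_ge_le_integral_of_nonneg (μ := Measure.pi fun _ : Fin n => ν)
    (f := fun xs => trace (NormedSpace.exp (θ • sumDev t xs) - 1 - θ • sumDev t xs))
    (.of_forall fun xs =>
      (posSemidef_exp_sub_one_sub ((isSymm_sumDev t xs).smul θ)).trace_nonneg)
    (integrable_pi_of_continuous hd (by fun_prop)) (Real.exp y - 1 - y)
  have hsub : {xs : Fin n → ι → ℝ |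
      ∃ u : ι → ℝ, 3 * n / 4 * (u ⬝ᵥ u) < u ⬝ᵥ sumDev t xs *ᵥ u} ⊆
      {xs | Real.exp y - 1 - y ≤
        trace (NormedSpace.exp (θ • sumDev t xs) - 1 - θ • sumDev t xs)} := by
    rintro xs ⟨u, hu⟩
    refine exp_sub_one_sub_le_trace ((isSymm_sumDev t xs).smul θ) (u := u) (by linarith) ?_
    rw [smul_mulVec, dotProduct_smul, smul_eq_mul, hy]
    have := mul_lt_mul_of_pos_left hu hθ0
    linarith
  have hmono := measureReal_mono (μ := Measure.pi fun _ : Fin n => ν) hsub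
  have hexp2 : Real.exp y / 2 ≤ Real.exp y - 1 - y := by
    have h7 : (7 : ℝ) ≤ Real.exp 2 := by
      have h1 : Real.exp 2 = Real.exp 1 ^ 2 := by rw [← Real.exp_nat_mul]; norm_num
      rw [h1]
      nlinarith [Real.exp_one_gt_d9]
    have h3 : (y - 1) * 7 ≤ Real.exp y := by
      have h4 := mul_le_mul (Real.add_one_le_exp (y - 2)) h7 (by norm_num) (Real.exp_pos _).le
      rw [← Real.exp_add, sub_add_cancel] at h4
      linarith
    linarith
  have hexpy : Real.exp (y / 2) ≤ Real.exp y * Real.exp (-L) := by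
    rw [← Real.exp_add, Real.exp_le_exp]
    linarith
  set p := (Measure.pi fun _ : Fin n => ν).real {xs : Fin n → ι → ℝ |
      ∃ u : ι → ℝ, 3 * n / 4 * (u ⬝ᵥ u) < u ⬝ᵥ sumDev t xs *ᵥ u} with hp
  have hp0 : 0 ≤ p := measureReal_nonneg
  have h1 : Real.exp y / 2 * p ≤ d * (Real.exp y * Real.exp (-L)) := by
    calc Real.exp y / 2 * p ≤ (Real.exp y - 1 - y) * p := mul_le_mul_of_nonneg_right hexp2 hp0
      _ ≤ _ := mul_le_mul_of_nonneg_left hmono (by linarith [Real.exp_pos y])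
      _ ≤ _ := hmarkov
      _ ≤ _ := hmgf
      _ ≤ _ := mul_le_mul_of_nonneg_left hexpy hd0.le
  have h2 : p ≤ 2 * d * (5 * δ / (16 * n)) := by
    rw [← hexpL]
    refine le_of_mul_le_mul_left ?_ (Real.exp_pos y)
    linarith
  refine h2.trans ?_
  rw [mul_div_assoc', div_le_iff₀ (by positivity)]
  nlinarith

end Matrix

section Approximation

variable {E : Type*} [NormedAddCommGroup E] [InnerProductSpace ℝ E] [CompleteSpace E] {n : ℕ}

/-- The regularized equation for an empirical covariance operator has a solution. -/
lemma exists_empiricalCov_add_smul_eq (a : Fin n → E) {l : ℝ} (hl : 0 < l) (f : E) :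
    ∃ w : E, (n : ℝ)⁻¹ • ∑ i, ⟪a i, w⟫ • a i + l • w = f := by
  let T : E →L[ℝ] E :=
    (n : ℝ)⁻¹ • ∑ i, (innerSL ℝ (a i)).smulRight (a i) + l • ContinuousLinearMap.id ℝ E
  have hT (w : E) : T w = (n : ℝ)⁻¹ • ∑ i, ⟪a i, w⟫ • a i + l • w := by simp [T]
  have hco : IsCoercive ((innerSL ℝ).comp T) := by
    refine ⟨l, hl, fun w => ?_⟩
    have : ⟪T w, w⟫ = (n : ℝ)⁻¹ * ∑ i, ⟪a i, w⟫ ^ 2 + l * ‖w‖ ^ 2 := by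
      simp only [hT, inner_add_left, real_inner_smul_left, sum_inner,
        real_inner_self_eq_norm_sq, sq]
    have h0 : 0 ≤ (n : ℝ)⁻¹ * ∑ i, ⟪a i, w⟫ ^ 2 := by positivity
    change l * ‖w‖ * ‖w‖ ≤ ⟪T w, w⟫
    rw [this]
    nlinarith
  have hB (w z : E) : ⟪hco.continuousLinearEquivOfBilin w, z⟫ = ⟪T w, z⟫ := by
    rw [hco.continuousLinearEquivOfBilin_apply]; rfl
  refine ⟨hco.continuousLinearEquivOfBilin.symm f, ?_⟩
  rw [← hT]
  refine ext_inner_right ℝ fun z => ?_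
  rw [← hB, ContinuousLinearEquiv.apply_symm_apply]

/-- Ridge regression on the vectors `a i`: a lower bound on their empirical covariance operator
in terms of `S` controls the approximation of any `f` dominated by `S`. -/
lemma exists_norm_sub_sum_smul_sq_le (S : E →L[ℝ] E) (a : Fin n → E) {l : ℝ} (hl : 0 < l)
    (hn : 0 < n)
    (hS : ∀ h, (⟪h, S h⟫ + l * ‖h‖ ^ 2) / 4 ≤ (n : ℝ)⁻¹ * ∑ i, ⟪a i, h⟫ ^ 2 + l * ‖h‖ ^ 2)
    {f : E} (hf : ∀ h, ⟪f, h⟫ ≤ 2 + ⟪h, S h⟫ / 8) :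
    ∃ β : Fin n → ℝ, ∑ i, β i ^ 2 ≤ 4 / n ∧ ‖f - ∑ i, β i • a i‖ ^ 2 ≤ 4 * l := by
  obtain ⟨w, hw⟩ := exists_empiricalCov_add_smul_eq a hl f
  have hn' : (0 : ℝ) < n := by exact_mod_cast hn
  have hc : ⟪f, w⟫ = (n : ℝ)⁻¹ * ∑ i, ⟪a i, w⟫ ^ 2 + l * ‖w‖ ^ 2 := by
    simp only [← hw, inner_add_left, real_inner_smul_left, sum_inner, real_inner_self_eq_norm_sq,
      sq]
  have h0 : 0 ≤ (n : ℝ)⁻¹ * ∑ i, ⟪a i, w⟫ ^ 2 := by positivity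
  have h1 : 0 ≤ l * ‖w‖ ^ 2 := by positivity
  have h4 : ⟪f, w⟫ ≤ 4 := by linarith [hS w, hf w]
  refine ⟨fun i => (n : ℝ)⁻¹ * ⟪a i, w⟫, ?_, ?_⟩
  · have : ∑ i, ((n : ℝ)⁻¹ * ⟪a i, w⟫) ^ 2 = ((n : ℝ)⁻¹ * ∑ i, ⟪a i, w⟫ ^ 2) / n := by
      simp only [mul_pow, ← Finset.mul_sum]
      field_simp
    rw [this]
    gcongr
    linarith
  · have : f - ∑ i, ((n : ℝ)⁻¹ * ⟪a i, w⟫) • a i = l • w := by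
      simp only [mul_smul, ← Finset.smul_sum]
      rw [sub_eq_iff_eq_add', hw]
    rw [this, norm_smul, Real.norm_of_nonneg hl.le, mul_pow]
    nlinarith

end Approximation

namespace Matrix

lemma dotProduct_sumDev_mulVec {ι : Type*} [Fintype ι] [DecidableEq ι] {n : ℕ} (t : ι → ℝ)
    (xs : Fin n → ι → ℝ) (u : ι → ℝ) :
    u ⬝ᵥ sumDev t xs *ᵥ u = n * ∑ j, t j * u j ^ 2 - ∑ i, (xs i ⬝ᵥ u) ^ 2 := by
  have hd : u ⬝ᵥ diagonal t *ᵥ u = ∑ j, t j * u j ^ 2 :=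
    Finset.sum_congr rfl fun j _ => by rw [mulVec_diagonal]; ring
  rw [sumDev, sum_mulVec, dotProduct_sum]
  simp only [rankOneDev, sub_mulVec, dotProduct_sub, hd, vecMulVec_mulVec,
    Finset.sum_sub_distrib, Finset.sum_const, Finset.card_univ, Fintype.card_fin, nsmul_eq_mul]
  congr 1
  refine Finset.sum_congr rfl fun i _ => ?_
  simp only [op_smul_eq_smul, dotProduct_smul, smul_eq_mul]
  rw [dotProduct_comm, sq]

end Matrix

section Spectral

open Matrix

variable {E : Type*} [NormedAddCommGroup E] [InnerProductSpace ℝ E]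
  {b : HilbertBasis ℕ ℝ E} {μ : ℕ → ℝ} {l : ℝ} {R S : E →L[ℝ] E} {n : ℕ}

/-- The coordinates, in an eigenbasis of the covariance operator, of the vector `x` multiplied by
the inverse square root of the regularized covariance operator. -/
noncomputable def whitened (b : HilbertBasis ℕ ℝ E) (μ : ℕ → ℝ) (l : ℝ) (N : ℕ) (x : E) :
    Fin N → ℝ :=
  fun j => ⟪b j, x⟫ / √(μ j + l)

lemma continuous_whitened (N : ℕ) : Continuous (whitened b μ l N) := by
  unfold whitened
  fun_prop

lemma hasSum_inner_resolvent (hR : ∀ j, R (b j) = (μ j + l)⁻¹ • b j) (x : E) :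
    HasSum (fun j => ⟪b j, x⟫ ^ 2 / (μ j + l)) ⟪x, R x⟫ := by
  have h : (fun j => ⟪b j, x⟫ ^ 2 / (μ j + l)) =
      fun j => (innerSL ℝ x).comp R (b.repr x j • b j) := by
    funext j
    simp only [ContinuousLinearMap.comp_apply, innerSL_apply_apply, map_smul, hR,
      b.repr_apply_apply, real_inner_comm (b j) x]
    ring
  rw [h]
  exact (b.hasSum_repr x).mapL ((innerSL ℝ x).comp R)

lemma inner_resolvent_nonneg (hR : ∀ j, R (b j) = (μ j + l)⁻¹ • b j) (hμ : ∀ j, 0 < μ j)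
    (hl : 0 < l) (x : E) : 0 ≤ ⟪x, R x⟫ :=
  (hasSum_inner_resolvent hR x).nonneg fun j => div_nonneg (sq_nonneg _) (by linarith [hμ j])

lemma inner_eq_zero_of_inner_resolvent_eq_zero (hR : ∀ j, R (b j) = (μ j + l)⁻¹ • b j)
    (hμ : ∀ j, 0 < μ j) (hl : 0 < l) {x : E} (hx : ⟪x, R x⟫ = 0) (j : ℕ) : ⟪b j, x⟫ = 0 := by
  have h := hasSum_inner_resolvent hR x
  have hp (j : ℕ) : 0 < μ j + l := by linarith [hμ j]
  rw [hx, hasSum_zero_iff_of_nonneg fun j => div_nonneg (sq_nonneg _) (hp j).le] at h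
  have := congrFun h j
  simpa [(hp j).ne'] using this

lemma whitened_dotProduct_self_le (hR : ∀ j, R (b j) = (μ j + l)⁻¹ • b j) (hμ : ∀ j, 0 < μ j)
    (hl : 0 < l) (N : ℕ) (x : E) :
    whitened b μ l N x ⬝ᵥ whitened b μ l N x ≤ ⟪x, R x⟫ := by
  have hp (j : ℕ) : 0 < μ j + l := by linarith [hμ j]
  have h := sum_le_hasSum (Finset.range N) (fun j _ => div_nonneg (sq_nonneg _) (hp j).le)
    (hasSum_inner_resolvent hR x)
  rw [Finset.sum_range] at h
  refine le_trans (le_of_eq (Finset.sum_congr rfl fun j _ => ?_)) h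
  rw [whitened, div_mul_div_comm, Real.mul_self_sqrt (hp j).le, sq]

/-- The bound on the empirical covariance operator holds on the span of the first eigenvectors as
soon as it holds for the whitened coordinates. -/
lemma le_empirical_of_sumDev_le (hS : ∀ j, S (b j) = μ j • b j) (hμ : ∀ j, 0 < μ j) (hl : 0 < l)
    (hn : 0 < n) (a : Fin n → E) {N : ℕ}
    (hN : ∀ u : Fin N → ℝ, u ⬝ᵥ sumDev (fun j => μ j / (μ j + l))
      (fun i => whitened b μ l N (a i)) *ᵥ u ≤ 3 * n / 4 * (u ⬝ᵥ u)) (c : Fin N → ℝ) :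
    (⟪∑ j, c j • b j, S (∑ j, c j • b j)⟫ + l * ‖∑ j, c j • b j‖ ^ 2) / 4 ≤
      (n : ℝ)⁻¹ * ∑ i, ⟪a i, ∑ j, c j • b j⟫ ^ 2 + l * ‖∑ j, c j • b j‖ ^ 2 := by
  have hp (j : ℕ) : 0 < μ j + l := by linarith [hμ j]
  have hn' : (0 : ℝ) < n := by exact_mod_cast hn
  have hon : Orthonormal ℝ fun j : Fin N => b j := b.orthonormal.comp _ Fin.val_injective
  have hnorm : ‖∑ j, c j • b j‖ ^ 2 = ∑ j, c j ^ 2 := by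
    rw [← real_inner_self_eq_norm_sq, hon.inner_sum]
    simp [sq]
  have hSin : ⟪∑ j, c j • b j, S (∑ j, c j • b j)⟫ = ∑ j : Fin N, μ j * c j ^ 2 := by
    have : S (∑ j, c j • b j) = ∑ j : Fin N, (μ j * c j) • b j := by
      simp only [map_sum, map_smul, hS, smul_smul, mul_comm]
    rw [this, hon.inner_sum]
    exact Finset.sum_congr rfl fun j _ => by simp; ring
  have h := hN fun j => √(μ j + l) * c j
  have hu : (fun j : Fin N => √(μ j + l) * c j) ⬝ᵥ (fun j => √(μ j + l) * c j) =
      ∑ j : Fin N, μ j * c j ^ 2 + l * ∑ j, c j ^ 2 := by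
    rw [Finset.mul_sum, ← Finset.sum_add_distrib]
    refine Finset.sum_congr rfl fun j _ => ?_
    rw [mul_mul_mul_comm, Real.mul_self_sqrt (hp j).le]
    ring
  have hx (i : Fin n) : whitened b μ l N (a i) ⬝ᵥ (fun j : Fin N => √(μ j + l) * c j) =
      ⟪a i, ∑ j, c j • b j⟫ := by
    rw [inner_sum]
    refine Finset.sum_congr rfl fun j _ => ?_
    have := (Real.sqrt_pos.2 (hp j)).ne'
    rw [whitened, real_inner_smul_right, real_inner_comm]
    field_simp
  have hd : ∑ j : Fin N, μ j / (μ j + l) * (√(μ j + l) * c j) ^ 2 =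
      ∑ j : Fin N, μ j * c j ^ 2 := by
    refine Finset.sum_congr rfl fun j _ => ?_
    rw [mul_pow, Real.sq_sqrt (hp j).le]
    have := (hp j).ne'
    field_simp
  simp only [dotProduct_sumDev_mulVec, hu, hd, hx] at h
  rw [hSin, hnorm]
  have h3 : (n : ℝ)⁻¹ * (n * ∑ j : Fin N, μ j * c j ^ 2 - ∑ i, ⟪a i, ∑ j, c j • b j⟫ ^ 2) ≤
      (n : ℝ)⁻¹ * (3 * n / 4 * (∑ j : Fin N, μ j * c j ^ 2 + l * ∑ j, c j ^ 2)) := by gcongr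
  have h4 : (n : ℝ)⁻¹ * (3 * n / 4 * (∑ j : Fin N, μ j * c j ^ 2 + l * ∑ j, c j ^ 2)) =
      3 / 4 * (∑ j : Fin N, μ j * c j ^ 2 + l * ∑ j, c j ^ 2) := by field_simp
  rw [mul_sub, inv_mul_cancel_left₀ hn'.ne', h4] at h3
  linarith

lemma le_empirical_of_forall_sumDev_le (hS : ∀ j, S (b j) = μ j • b j) (hμ : ∀ j, 0 < μ j)
    (hl : 0 < l) (hn : 0 < n) (a : Fin n → E)
    (hN : ∀ (N : ℕ) (u : Fin N → ℝ), u ⬝ᵥ sumDev (fun j => μ j / (μ j + l))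
      (fun i => whitened b μ l N (a i)) *ᵥ u ≤ 3 * n / 4 * (u ⬝ᵥ u)) (h : E) :
    (⟪h, S h⟫ + l * ‖h‖ ^ 2) / 4 ≤ (n : ℝ)⁻¹ * ∑ i, ⟪a i, h⟫ ^ 2 + l * ‖h‖ ^ 2 := by
  have ht : Filter.Tendsto (fun N => ∑ j : Fin N, b.repr h j • b j) Filter.atTop (nhds h) := by
    simpa only [Finset.sum_range] using (b.hasSum_repr h).tendsto_sum_nat
  have hc₁ : Continuous fun h => (⟪h, S h⟫ + l * ‖h‖ ^ 2) / 4 := by fun_prop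
  have hc₂ : Continuous fun h => (n : ℝ)⁻¹ * ∑ i, ⟪a i, h⟫ ^ 2 + l * ‖h‖ ^ 2 := by fun_prop
  exact le_of_tendsto_of_tendsto' ((hc₁.tendsto h).comp ht) ((hc₂.tendsto h).comp ht) fun N =>
    le_empirical_of_sumDev_le hS hμ hl hn a (hN N) fun j => b.repr h j

/-- Failure of the bound on whitened coordinates is inherited by longer coordinate vectors. -/
lemma exists_lt_sumDev_mono {N M : ℕ} (hNM : N ≤ M) (a : Fin n → E)
    (h : ∃ u : Fin N → ℝ, 3 * n / 4 * (u ⬝ᵥ u) < u ⬝ᵥ sumDev (fun j => μ j / (μ j + l))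
      (fun i => whitened b μ l N (a i)) *ᵥ u) :
    ∃ u : Fin M → ℝ, 3 * n / 4 * (u ⬝ᵥ u) < u ⬝ᵥ sumDev (fun j => μ j / (μ j + l))
      (fun i => whitened b μ l M (a i)) *ᵥ u := by
  obtain ⟨u, hu⟩ := h
  obtain ⟨k, rfl⟩ := Nat.exists_eq_add_of_le hNM
  refine ⟨Fin.append u 0, ?_⟩
  simp only [dotProduct_sumDev_mulVec] at hu ⊢
  simpa [dotProduct, Fin.sum_univ_add, whitened] using hu

end Spectral

section RandomFeatures

variable {E : Type*} [NormedAddCommGroup E] [InnerProductSpace ℝ E]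
  {b : HilbertBasis ℕ ℝ E} {μ : ℕ → ℝ} {l : ℝ} {R S : E →L[ℝ] E}
  {V : Type*} [MeasurableSpace V] {τ : Measure V} {φ : V → E}

lemma MeasureTheory.MemLp.integrable_inner_apply (hφ : MemLp φ 2 τ) (R : E →L[ℝ] E) :
    Integrable (fun v => ⟪φ v, R (φ v)⟫) τ := by
  refine ((hφ.integrable_norm_pow two_ne_zero).const_mul ‖R‖).mono'
    (hφ.1.inner (R.continuous.comp_aestronglyMeasurable hφ.1)) (.of_forall fun v => ?_)
  calc ‖⟪φ v, R (φ v)⟫‖ ≤ ‖φ v‖ * ‖R (φ v)‖ := norm_inner_le_norm _ _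
    _ ≤ ‖φ v‖ * (‖R‖ * ‖φ v‖) := by gcongr; exact R.le_opNorm _
    _ = ‖R‖ * ‖φ v‖ ^ 2 := by ring

lemma MeasureTheory.MemLp.integrable_inner_mul_inner (hφ : MemLp φ 2 τ) (x y : E) :
    Integrable (fun v => ⟪x, φ v⟫ * ⟪φ v, y⟫) τ :=
  (hφ.const_inner x).integrable_mul (hφ.inner_const y)

/-- An element of the unit ball of the reproducing kernel Hilbert space is dominated by the
covariance operator. -/
lemma inner_integral_smul_le [CompleteSpace E] (hφ : MemLp φ 2 τ)
    (hS : ∀ x y, ⟪x, S y⟫ = ∫ v, ⟪x, φ v⟫ * ⟪φ v, y⟫ ∂τ) {g : Lp ℝ 2 τ} (hg : ‖g‖ ≤ 1) (h : E) :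
    ⟪∫ v, g v • φ v ∂τ, h⟫ ≤ 2 + ⟪h, S h⟫ / 8 := by
  have hg2 := Lp.memLp g
  have hint : Integrable (fun v => g v • φ v) τ := memLp_one_iff_integrable.1 (hφ.smul hg2)
  have hgsq : ∫ v, g v ^ 2 ∂τ ≤ 1 := by
    have h1 : ⟪g, g⟫ = ∫ v, g v ^ 2 ∂τ := by
      rw [L2.inner_def]
      exact integral_congr_ae (.of_forall fun v => by simp [sq])
    rw [← h1, real_inner_self_eq_norm_sq]
    exact pow_le_one₀ (norm_nonneg _) hg
  rw [real_inner_comm, ← integral_inner hint, hS]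
  have hb : Integrable (fun v => 2 * g v ^ 2 + ⟪h, φ v⟫ * ⟪φ v, h⟫ / 8) τ :=
    (hg2.integrable_sq.const_mul 2).add ((hφ.integrable_inner_mul_inner h h).div_const 8)
  calc ∫ v, ⟪h, g v • φ v⟫ ∂τ ≤ ∫ v, (2 * g v ^ 2 + ⟪h, φ v⟫ * ⟪φ v, h⟫ / 8) ∂τ := by
        refine integral_mono (hint.const_inner h) hb fun v => ?_
        simp only [real_inner_smul_right, real_inner_comm h (φ v)]
        nlinarith [sq_nonneg (4 * g v - ⟪h, φ v⟫)]
    _ = 2 * ∫ v, g v ^ 2 ∂τ + (∫ v, ⟪h, φ v⟫ * ⟪φ v, h⟫ ∂τ) / 8 := by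
        rw [integral_add (hg2.integrable_sq.const_mul 2)
          ((hφ.integrable_inner_mul_inner h h).div_const 8), integral_const_mul, integral_div]
    _ ≤ _ := by linarith

lemma integral_inner_mul_inner_eq (hS : ∀ x y, ⟪x, S y⟫ = ∫ v, ⟪x, φ v⟫ * ⟪φ v, y⟫ ∂τ)
    (hSb : ∀ j, S (b j) = μ j • b j) (j k : ℕ) :
    ∫ v, ⟪b j, φ v⟫ * ⟪b k, φ v⟫ ∂τ = if j = k then μ j else 0 := by
  have := hS (b j) (b k)
  simp only [hSb, real_inner_smul_right, orthonormal_iff_ite.1 b.orthonormal] at this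
  simp only [real_inner_comm _ (b k), ← this]
  split_ifs with h <;> simp [h]

/-- The effective dimension is the sum of the filtered eigenvalues. -/
lemma hasSum_effectiveDim (hφ : MemLp φ 2 τ)
    (hS : ∀ x y, ⟪x, S y⟫ = ∫ v, ⟪x, φ v⟫ * ⟪φ v, y⟫ ∂τ)
    (hSb : ∀ j, S (b j) = μ j • b j) (hR : ∀ j, R (b j) = (μ j + l)⁻¹ • b j)
    (hμ : ∀ j, 0 < μ j) (hμs : Summable μ) (hl : 0 < l) :
    HasSum (fun j => μ j / (μ j + l)) (∫ v, ⟪φ v, R (φ v)⟫ ∂τ) := by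
  have hp (j : ℕ) : 0 < μ j + l := by linarith [hμ j]
  have hint (j : ℕ) : ∫ v, ⟪b j, φ v⟫ ^ 2 / (μ j + l) ∂τ = μ j / (μ j + l) := by
    rw [integral_div]
    simp only [sq, integral_inner_mul_inner_eq hS hSb, if_true]
  have hnorm (j : ℕ) (v : V) :
      ‖⟪b j, φ v⟫ ^ 2 / (μ j + l)‖ = ⟪b j, φ v⟫ ^ 2 / (μ j + l) :=
    Real.norm_of_nonneg (div_nonneg (sq_nonneg _) (hp j).le)
  have h := hasSum_integral_of_summable_integral_norm (μ := τ)
    (F := fun j v => ⟪b j, φ v⟫ ^ 2 / (μ j + l))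
    (fun j => (hφ.const_inner (b j)).integrable_sq.div_const _) (by
      simp only [hnorm, hint]
      refine (hμs.div_const l).of_nonneg_of_le (fun j => div_nonneg (hμ j).le (hp j).le) fun j => ?_
      gcongr
      · exact (hμ j).le
      · linarith [hμ j])
  simpa only [hint, (hasSum_inner_resolvent hR _).tsum_eq] using h

/-- A tail bound on the eigenvalues bounds the effective dimension. -/
lemma tsum_div_add_le {μ : ℕ → ℝ} (hμ : ∀ j, 0 < μ j) (hμs : Summable μ) {m : ℕ} {C : ℝ}
    (hC : ∑' i, μ (m + i) ≤ C * μ m) :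
    ∑' j, μ j / (μ j + μ m) ≤ m + C := by
  have hm := hμ m
  have hle (j : ℕ) : μ j / (μ j + μ m) ≤ μ j / μ m := by
    gcongr
    · exact (hμ j).le
    · linarith [hμ j]
  have hs : Summable fun j => μ j / (μ j + μ m) :=
    (hμs.div_const (μ m)).of_nonneg_of_le
      (fun j => div_nonneg (hμ j).le (by linarith [hμ j])) hle
  rw [← hs.sum_add_tsum_nat_add m]
  gcongr
  · calc ∑ j ∈ Finset.range m, μ j / (μ j + μ m) ≤ ∑ j ∈ Finset.range m, (1 : ℝ) :=
          Finset.sum_le_sum fun j _ => div_le_one_of_le₀ (by linarith) (by linarith [hμ j])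
      _ = m := by simp
  · calc ∑' i, μ (i + m) / (μ (i + m) + μ m) ≤ ∑' i, μ (i + m) / μ m :=
          ((summable_nat_add_iff m).2 hs).tsum_le_tsum (fun i => hle _)
            ((summable_nat_add_iff m).2 (hμs.div_const (μ m)))
      _ ≤ C := by
          rw [tsum_div_const, div_le_iff₀ hm]
          simpa only [add_comm] using hC

/-- The optimal sampling density for random features. -/
noncomputable def samplingDensity (τ : Measure V) (φ : V → E) (R : E →L[ℝ] E) (v : V) : ℝ :=
  ⟪φ v, R (φ v)⟫ / ∫ w, ⟪φ w, R (φ w)⟫ ∂τ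

/-- The feature vectors normalized by the square root of the sampling density. -/
noncomputable def normalizedFeature (τ : Measure V) (φ : V → E) (R : E →L[ℝ] E) (v : V) : E :=
  (√(samplingDensity τ φ R v))⁻¹ • φ v

/-- The optimal sampling distribution for random features. -/
noncomputable def samplingMeasure (τ : Measure V) (φ : V → E) (R : E →L[ℝ] E) : Measure V :=
  τ.withDensity fun v => ENNReal.ofReal (samplingDensity τ φ R v)

lemma integrable_samplingDensity (hφ : MemLp φ 2 τ) : Integrable (samplingDensity τ φ R) τ :=
  (hφ.integrable_inner_apply R).div_const _

lemma samplingDensity_nonneg (hR : ∀ j, R (b j) = (μ j + l)⁻¹ • b j) (hμ : ∀ j, 0 < μ j)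
    (hl : 0 < l) (v : V) : 0 ≤ samplingDensity τ φ R v :=
  div_nonneg (inner_resolvent_nonneg hR hμ hl _)
    (integral_nonneg fun _ => inner_resolvent_nonneg hR hμ hl _)

lemma isProbabilityMeasure_samplingMeasure (hφ : MemLp φ 2 τ)
    (hR : ∀ j, R (b j) = (μ j + l)⁻¹ • b j) (hμ : ∀ j, 0 < μ j) (hl : 0 < l)
    (hd : 0 < ∫ w, ⟪φ w, R (φ w)⟫ ∂τ) : IsProbabilityMeasure (samplingMeasure τ φ R) := by
  refine ⟨?_⟩
  rw [samplingMeasure, withDensity_apply _ .univ, Measure.restrict_univ,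
    ← ofReal_integral_eq_lintegral_ofReal (integrable_samplingDensity hφ)
      (.of_forall fun v => samplingDensity_nonneg hR hμ hl v)]
  simp only [samplingDensity, integral_div, div_self hd.ne', ENNReal.ofReal_one]

lemma aestronglyMeasurable_normalizedFeature (hφ : MemLp φ 2 τ) :
    AEStronglyMeasurable (normalizedFeature τ φ R) (samplingMeasure τ φ R) := by
  have h : AEStronglyMeasurable (fun v => (√(samplingDensity τ φ R v))⁻¹) τ :=
    (integrable_samplingDensity (R := R) hφ).1.aemeasurable.sqrt.inv.aestronglyMeasurable
  exact (h.smul hφ.1).mono_ac (withDensity_absolutelyContinuous _ _)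

lemma inner_normalizedFeature_resolvent_le (hR : ∀ j, R (b j) = (μ j + l)⁻¹ • b j)
    (hμ : ∀ j, 0 < μ j) (hl : 0 < l) (v : V) :
    ⟪normalizedFeature τ φ R v, R (normalizedFeature τ φ R v)⟫ ≤ ∫ w, ⟪φ w, R (φ w)⟫ ∂τ := by
  have hd : 0 ≤ ∫ w, ⟪φ w, R (φ w)⟫ ∂τ :=
    integral_nonneg fun _ => inner_resolvent_nonneg hR hμ hl _
  simp only [normalizedFeature, map_smul, real_inner_smul_left, real_inner_smul_right]
  rw [← mul_assoc, ← mul_inv, Real.mul_self_sqrt (samplingDensity_nonneg hR hμ hl v),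
    samplingDensity, inv_div, div_mul_eq_mul_div]
  rcases eq_or_ne ⟪φ v, R (φ v)⟫ 0 with h | h
  · simpa [h] using hd
  · rw [mul_div_cancel_right₀ _ h]

lemma integral_whitened_mul_whitened (hφ : MemLp φ 2 τ)
    (hS : ∀ x y, ⟪x, S y⟫ = ∫ v, ⟪x, φ v⟫ * ⟪φ v, y⟫ ∂τ)
    (hSb : ∀ j, S (b j) = μ j • b j) (hR : ∀ j, R (b j) = (μ j + l)⁻¹ • b j)
    (hμ : ∀ j, 0 < μ j) (hl : 0 < l) (hd : 0 < ∫ w, ⟪φ w, R (φ w)⟫ ∂τ) {N : ℕ} (j k : Fin N) :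
    ∫ v, whitened b μ l N (normalizedFeature τ φ R v) j *
        whitened b μ l N (normalizedFeature τ φ R v) k ∂samplingMeasure τ φ R =
      if j = k then μ j / (μ j + l) else 0 := by
  have hp (j : ℕ) : 0 < μ j + l := by linarith [hμ j]
  have hpt (v : V) : (ENNReal.ofReal (samplingDensity τ φ R v)).toReal •
      (whitened b μ l N (normalizedFeature τ φ R v) j *
        whitened b μ l N (normalizedFeature τ φ R v) k) =
      ⟪b j, φ v⟫ * ⟪b k, φ v⟫ / (√(μ j + l) * √(μ k + l)) := by
    have hq := samplingDensity_nonneg (τ := τ) (φ := φ) hR hμ hl v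
    rw [ENNReal.toReal_ofReal hq]
    simp only [whitened, normalizedFeature, real_inner_smul_right, smul_eq_mul]
    rcases hq.eq_or_lt with h0 | h0
    · have : ⟪φ v, R (φ v)⟫ = 0 := by
        simpa [samplingDensity, hd.ne'] using h0.symm
      simp [inner_eq_zero_of_inner_resolvent_eq_zero hR hμ hl this]
    · have hsq := Real.mul_self_sqrt hq
      have hs := (Real.sqrt_pos.2 h0).ne'
      generalize √(samplingDensity τ φ R v) = s at hsq hs
      have hj := (Real.sqrt_pos.2 (hp j)).ne'
      have hk := (Real.sqrt_pos.2 (hp k)).ne'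
      rw [← hsq]
      field_simp
  rw [samplingMeasure, integral_withDensity_eq_integral_toReal_smul₀
    (integrable_samplingDensity hφ).1.aemeasurable.ennreal_ofReal
    (.of_forall fun _ => ENNReal.ofReal_lt_top)]
  simp only [hpt, integral_div, integral_inner_mul_inner_eq hS hSb, Fin.val_inj]
  split_ifs with h
  · rw [h, Real.mul_self_sqrt (hp k).le]
  · simp

end RandomFeatures

section SampledFeatures

open Matrix

variable {E : Type*} [NormedAddCommGroup E] [InnerProductSpace ℝ E]
  {b : HilbertBasis ℕ ℝ E} {μ : ℕ → ℝ} {l : ℝ} {R S : E →L[ℝ] E}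
  {V : Type*} [MeasurableSpace V] {τ : Measure V} {φ : V → E} {n : ℕ}

lemma measure_exists_lt_sumDev_le (hφ : MemLp φ 2 τ)
    (hS : ∀ x y, ⟪x, S y⟫ = ∫ v, ⟪x, φ v⟫ * ⟪φ v, y⟫ ∂τ)
    (hSb : ∀ j, S (b j) = μ j • b j) (hR : ∀ j, R (b j) = (μ j + l)⁻¹ • b j)
    (hμ : ∀ j, 0 < μ j) (hμs : Summable μ) (hl : 0 < l) {δ : ℝ} (hδ : δ ∈ Set.Ioo (0 : ℝ) 1)
    (hn : 0 < n)
    (hnL : 5 * ((∫ w, ⟪φ w, R (φ w)⟫ ∂τ) + 1) * Real.log (16 * n / (5 * δ)) ≤ n) (N : ℕ) :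
    (Measure.pi fun _ : Fin n => samplingMeasure τ φ R)
      {vs | ∃ u : Fin N → ℝ, 3 * n / 4 * (u ⬝ᵥ u) < u ⬝ᵥ sumDev (fun j => μ j / (μ j + l))
        (fun i => whitened b μ l N (normalizedFeature τ φ R (vs i))) *ᵥ u} ≤
      ENNReal.ofReal δ := by
  have hp (j : ℕ) : 0 < μ j + l := by linarith [hμ j]
  have hdim := hasSum_effectiveDim hφ hS hSb hR hμ hμs hl
  have ht0 (j : ℕ) : 0 ≤ μ j / (μ j + l) := div_nonneg (hμ j).le (hp j).le
  have hd : 0 < ∫ w, ⟪φ w, R (φ w)⟫ ∂τ :=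
    (div_pos (hμ 0) (hp 0)).trans_le (le_hasSum hdim 0 fun j _ => ht0 j)
  have hprob := isProbabilityMeasure_samplingMeasure hφ hR hμ hl hd
  set ψ : V → Fin N → ℝ := fun v => whitened b μ l N (normalizedFeature τ φ R v)
  have hψ : AEMeasurable ψ (samplingMeasure τ φ R) :=
    ((continuous_whitened N).comp_aestronglyMeasurable
      (aestronglyMeasurable_normalizedFeature hφ)).aemeasurable
  have hprob' := Measure.isProbabilityMeasure_map hψ
  have hbound : ∀ᵐ x ∂(samplingMeasure τ φ R).map ψ, x ⬝ᵥ x ≤ ∫ w, ⟪φ w, R (φ w)⟫ ∂τ := by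
    refine (ae_map_iff hψ (measurableSet_le (by fun_prop) measurable_const)).2
      (.of_forall fun v => ?_)
    exact (whitened_dotProduct_self_le hR hμ hl N _).trans
      (inner_normalizedFeature_resolvent_le hR hμ hl v)
  have hcov (i j : Fin N) : ∫ x, x i * x j ∂(samplingMeasure τ φ R).map ψ =
      if i = j then μ i / (μ i + l) else 0 := by
    rw [integral_map hψ (Continuous.aestronglyMeasurable (by fun_prop))]
    exact integral_whitened_mul_whitened hφ hS hSb hR hμ hl hd i j
  have hsum : ∑ j : Fin N, μ j / (μ j + l) ≤ ∫ w, ⟪φ w, R (φ w)⟫ ∂τ := by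
    rw [← Finset.sum_range fun j => μ j / (μ j + l)]
    exact sum_le_hasSum _ (fun j _ => ht0 j) hdim
  have hmain := measureReal_exists_lt_quadratic_le hbound hd hcov (fun j => ht0 j)
    (fun j => div_le_one_of_le₀ (by linarith) (hp j).le) hsum hδ hn hnL
  rw [← Measure.pi_map_pi fun _ => hψ] at hmain
  have hψn : AEMeasurable (fun (vs : Fin n → V) i => ψ (vs i))
      (Measure.pi fun _ : Fin n => samplingMeasure τ φ R) :=
    aemeasurable_pi_lambda _ fun i =>
      hψ.comp_quasiMeasurePreserving (Measure.quasiMeasurePreserving_eval _ i)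
  have hprobn := Measure.isProbabilityMeasure_map hψn
  exact (Measure.le_map_apply hψn _).trans
    ((ENNReal.le_ofReal_iff_toReal_le (measure_ne_top _ _) hδ.1.le).2 hmain)

/-- With high probability, the lower bound on the empirical covariance operator holds in all
directions. -/
lemma measure_iUnion_exists_lt_sumDev_le (hφ : MemLp φ 2 τ)
    (hS : ∀ x y, ⟪x, S y⟫ = ∫ v, ⟪x, φ v⟫ * ⟪φ v, y⟫ ∂τ)
    (hSb : ∀ j, S (b j) = μ j • b j) (hR : ∀ j, R (b j) = (μ j + l)⁻¹ • b j)
    (hμ : ∀ j, 0 < μ j) (hμs : Summable μ) (hl : 0 < l) {δ : ℝ} (hδ : δ ∈ Set.Ioo (0 : ℝ) 1)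
    (hn : 0 < n)
    (hnL : 5 * ((∫ w, ⟪φ w, R (φ w)⟫ ∂τ) + 1) * Real.log (16 * n / (5 * δ)) ≤ n) :
    (Measure.pi fun _ : Fin n => samplingMeasure τ φ R)
      (⋃ N : ℕ, {vs | ∃ u : Fin N → ℝ,
        3 * n / 4 * (u ⬝ᵥ u) < u ⬝ᵥ sumDev (fun j => μ j / (μ j + l))
          (fun i => whitened b μ l N (normalizedFeature τ φ R (vs i))) *ᵥ u}) ≤
      ENNReal.ofReal δ := by
  have hmono : Monotone fun N : ℕ => {vs : Fin n → V | ∃ u : Fin N → ℝ,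
      3 * n / 4 * (u ⬝ᵥ u) < u ⬝ᵥ sumDev (fun j => μ j / (μ j + l))
        (fun i => whitened b μ l N (normalizedFeature τ φ R (vs i))) *ᵥ u} :=
    fun N M hNM vs h => exists_lt_sumDev_mono hNM (fun i => normalizedFeature τ φ R (vs i)) h
  rw [hmono.measure_iUnion]
  exact iSup_le fun N => measure_exists_lt_sumDev_le hφ hS hSb hR hμ hμs hl hδ hn hnL N

end SampledFeatures

/-!
STATEMENT 3 (Prop. 2(b)): Assume the non-increasing eigenvalue sequence (μ_m)_{m≥1} of Σ
satisfies Σ_{m=j}^∞ μ_m ≤ γ j μ_j for all j ≥ 1.  Let δ ∈ (0,1), m a positive integer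
with m ≤ n / (5(1+γ) log(16n/(5δ))), λ = μ_m,
q*_λ(v) = ⟨φ(v,·),(Σ+λI)⁻¹φ(v,·)⟩ / tr[Σ(Σ+λI)⁻¹], v_1,…,v_n i.i.d. from q*_λ dτ.
Then with probability at least 1−δ, every f in the unit ball of F admits f̂ in the ball of
radius 2 of the RKHS F̂ of k̂(x,y) = (1/n)Σ_i q*_λ(v_i)⁻¹φ(v_i,x)φ(v_i,y) with
‖f − f̂‖²_{L²(dρ)} ≤ 4μ_m.
Encoding: `φ v` is φ(v,·) ∈ L²(dρ); `Sop` is Σ; `e`/`μ` are its orthonormal basis of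
eigenfunctions/eigenvalues, 0-indexed (`μ m` is the paper's μ_{m+1}, so the tail condition
reads Σ_i μ(j+i) ≤ γ(j+1)μ j and the paper's choice of m ≥ 1 becomes m+1 ≤ n/(5(1+γ)log…)
with λ = μ m); `R` is (Σ+μ_m I)⁻¹; tr[Σ(Σ+λI)⁻¹] = ∫⟨φ v, Rφ v⟩dτ; the unit ball of F is
{∫ g(v)φ(v,·)dτ : ‖g‖_{L²(dτ)} ≤ 1}; elements of F̂ of norm ≤ 2 are exactly
Σ_i β_i q*_λ(v_i)^{-1/2}φ(v_i,·) with ‖β‖₂² ≤ 4/n (attained infimum, existential form).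
-/

theorem statement3 {X V : Type*} [MeasurableSpace X] [MeasurableSpace V]
    (ρ : Measure X) [IsProbabilityMeasure ρ] (τ : Measure V) [IsProbabilityMeasure τ]
    (φ : V → Lp ℝ 2 ρ) (hφmeas : AEStronglyMeasurable φ τ)
    (hφint : Integrable (fun v => ‖φ v‖ ^ 2) τ)
    (Sop : Lp ℝ 2 ρ →L[ℝ] Lp ℝ 2 ρ)
    (hSop : ∀ a b : Lp ℝ 2 ρ, ⟪a, Sop b⟫ = ∫ v, ⟪a, φ v⟫ * ⟪φ v, b⟫ ∂τ)
    (μ : ℕ → ℝ) (e : ℕ → Lp ℝ 2 ρ)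
    (he : Orthonormal ℝ e)
    (hspan : (Submodule.span ℝ (Set.range e)).topologicalClosure = ⊤)
    (heig : ∀ j, Sop (e j) = μ j • e j)
    (hμmono : Antitone μ) (hμpos : ∀ j, 0 < μ j) (hμsum : Summable μ)
    (γ : ℝ) (hγ : 0 < γ)
    (hcond : ∀ j : ℕ, (∑' i : ℕ, μ (j + i)) ≤ γ * ((j : ℝ) + 1) * μ j)
    (δ : ℝ) (hδ : δ ∈ Set.Ioo (0 : ℝ) 1)
    (n : ℕ) (hn : 0 < n)
    (m : ℕ)
    (hm : ((m : ℝ) + 1) ≤ (n : ℝ) / (5 * (1 + γ) * Real.log (16 * n / (5 * δ))))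
    (R : Lp ℝ 2 ρ →L[ℝ] Lp ℝ 2 ρ)
    (hR : ∀ f, Sop (R f) + μ m • R f = f)
    (hR' : ∀ f, R (Sop f + μ m • f) = f) :
    (Measure.pi fun _ : Fin n => τ.withDensity fun v =>
        ENNReal.ofReal (⟪φ v, R (φ v)⟫ / ∫ w, ⟪φ w, R (φ w)⟫ ∂τ))
        {vs : Fin n → V |
          ∀ f : Lp ℝ 2 ρ,
            (∃ g : Lp ℝ 2 τ, ‖g‖ ≤ 1 ∧ f = ∫ v, (g : V → ℝ) v • φ v ∂τ) →
            ∃ β : Fin n → ℝ, (∑ i, β i ^ 2) ≤ 4 / n ∧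
              ‖f - ∑ i, (β i /
                  Real.sqrt (⟪φ (vs i), R (φ (vs i))⟫ / ∫ w, ⟪φ w, R (φ w)⟫ ∂τ)) •
                    φ (vs i)‖ ^ 2 ≤ 4 * μ m}
      ≥ ENNReal.ofReal (1 - δ) := by
  have hφ : MemLp φ 2 τ := (memLp_two_iff_integrable_sq_norm hφmeas).2 hφint
  obtain ⟨b, hb⟩ : ∃ b : HilbertBasis ℕ ℝ (Lp ℝ 2 ρ), ∀ j, b j = e j :=
    ⟨.mk he hspan.ge, fun j => by rw [HilbertBasis.coe_mk]⟩
  have hl := hμpos m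
  have hp (j : ℕ) : 0 < μ j + μ m := by linarith [hμpos j]
  have hSb (j : ℕ) : Sop (b j) = μ j • b j := by rw [hb, heig]
  have hRb (j : ℕ) : R (b j) = (μ j + μ m)⁻¹ • b j := by
    have := hR' (b j)
    rw [hSb, ← add_smul, map_smul] at this
    rw [eq_inv_smul_iff₀ (hp j).ne', this]
  have hdim := hasSum_effectiveDim hφ hSop hSb hRb hμpos hμsum hl
  have hd0 : 0 < ∫ w, ⟪φ w, R (φ w)⟫ ∂τ :=
    (div_pos (hμpos 0) (hp 0)).trans_le
      (le_hasSum hdim 0 fun j _ => div_nonneg (hμpos j).le (hp j).le)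
  have hd : ∫ w, ⟪φ w, R (φ w)⟫ ∂τ ≤ m + γ * (m + 1) := by
    rw [← hdim.tsum_eq]
    exact tsum_div_add_le hμpos hμsum (hcond m)
  have hlog : 0 < Real.log (16 * n / (5 * δ)) := by
    have hn1 : (1 : ℝ) ≤ n := by exact_mod_cast hn
    refine Real.log_pos ((one_lt_div (by linarith [hδ.1])).2 ?_)
    linarith [hδ.2]
  have hnL : 5 * ((∫ w, ⟪φ w, R (φ w)⟫ ∂τ) + 1) * Real.log (16 * n / (5 * δ)) ≤ n := by
    rw [le_div_iff₀ (by positivity)] at hm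
    refine le_trans ?_ hm
    have : (∫ w, ⟪φ w, R (φ w)⟫ ∂τ) + 1 ≤ (m + 1) * (1 + γ) := by linarith
    nlinarith
  have hprob := isProbabilityMeasure_samplingMeasure hφ hRb hμpos hl hd0
  have hbad := measure_iUnion_exists_lt_sumDev_le hφ hSop hSb hRb hμpos hμsum hl hδ hn hnL
  change ENNReal.ofReal (1 - δ) ≤ (Measure.pi fun _ : Fin n => samplingMeasure τ φ R) _
  rw [ENNReal.ofReal_sub _ hδ.1.le, ENNReal.ofReal_one, tsub_le_iff_right,
    ← measure_univ (μ := Measure.pi fun _ : Fin n => samplingMeasure τ φ R)]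
  refine le_trans (measure_mono fun vs _ => ?_) ((measure_union_le _ _).trans
    (add_le_add_right hbad _))
  refine or_iff_not_imp_right.2 fun hvs => ?_
  simp only [Set.mem_iUnion, Set.mem_ofPred_eq, not_exists, not_lt] at hvs
  rintro f ⟨g, hg, rfl⟩
  obtain ⟨β, hβ, hβf⟩ := exists_norm_sub_sum_smul_sq_le Sop
    (fun i => normalizedFeature τ φ R (vs i)) hl hn
    (le_empirical_of_forall_sumDev_le hSb hμpos hl hn _ hvs) (inner_integral_smul_le hφ hSop hg)
  refine ⟨β, hβ, ?_⟩
  simpa only [normalizedFeature, samplingDensity, smul_smul, ← div_eq_mul_inv] using hβf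
end

section
/- Let δ ∈ (0,1) and λ > 0. If there exists a family ψ_1,…,ψ_n ∈ L2(dρ) such that (1/n) Σ_{i=1}^n ‖ψ_i‖²_{L2(dρ)} ≤ 2 (tr Σ)/δ and such that sup over all f ∈ F with ‖f‖_F ≤ 1 of the infimum over β ∈ ℝ^n with ‖β‖_2² ≤ 4/n of ‖f − Σ_{i=1}^n β_i ψ_i‖²_{L2(dρ)} is at most 4λ, then n ≥ max{m ≥ 1 : μ_m ≥ 144λ} / (4 log(10 (tr Σ)/(λδ))). -/
open MeasureTheory
open scoped ENNReal RealInnerProductSpace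

/-!
STATEMENT 4 (Prop. 3, lower bound): If ψ_1,…,ψ_n ∈ L²(dρ) satisfy
(1/n)Σ_i ‖ψ_i‖² ≤ 2(tr Σ)/δ and
sup_{‖f‖_F ≤ 1} inf_{‖β‖₂² ≤ 4/n} ‖f − Σ_i β_i ψ_i‖²_{L²(dρ)} ≤ 4λ,
then n ≥ max{m : μ_m ≥ 144λ} / (4 log(10(tr Σ)/(λδ))).
Encoding: `Sop` is the integral operator Σ with orthonormal eigenbasis `e` and
non-increasing positive summable eigenvalues `μ` (0-indexed: `μ j` is the paper's μ_{j+1},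
so max{m ≥ 1 : μ_m ≥ 144λ} = #{j : ℕ | μ j ≥ 144λ}), and tr Σ = Σ'_j μ_j; `S` is the
positive self-adjoint square root Σ^{1/2}, so that the unit ball of F is the image under
`S` of the unit ball of L²(dρ); the infimum over the β-ball is over the corresponding
subtype, and the hypothesis "sup ≤ 4λ" is expressed as "for every f in the unit ball of F,
the infimum is ≤ 4λ".
-/

/-- If `S` is symmetric and `S ∘ S` acts on the orthonormal family `e` by multiplication by
`μ j ≥ c`, then `‖S g‖² ≥ c ‖g‖²` on the span of `e`. -/
lemma mul_norm_sq_le_norm_map_sq {E ι : Type*} [NormedAddCommGroup E] [InnerProductSpace ℝ E]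
    [Fintype ι] {e : ι → E} (he : Orthonormal ℝ e) (S : E →L[ℝ] E)
    (hS : ∀ f g : E, ⟪S f, g⟫ = ⟪f, S g⟫) {μ : ι → ℝ} (heig : ∀ j, S (S (e j)) = μ j • e j)
    {c : ℝ} (hc : ∀ j, c ≤ μ j) (a : ι → ℝ) :
    c * ‖∑ j, a j • e j‖ ^ 2 ≤ ‖S (∑ j, a j • e j)‖ ^ 2 := by
  have hSS : S (S (∑ j, a j • e j)) = ∑ j, (a j * μ j) • e j := by
    simp [map_sum, heig, smul_smul]
  rw [← real_inner_self_eq_norm_sq, ← real_inner_self_eq_norm_sq, hS, hSS,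
    he.inner_sum, he.inner_sum, Finset.mul_sum]
  refine Finset.sum_le_sum fun j _ => ?_
  simp only [conj_trivial]
  nlinarith [mul_le_mul_of_nonneg_right (hc j) (mul_self_nonneg (a j))]

/-- If `S ∘ S` has more than `n` orthonormal eigenvectors with eigenvalues at least `c`, then some
unit vector has an image under `S` whose squared distance to every combination of `n` given
vectors is at least `c`. -/
lemma exists_norm_eq_one_forall_le_norm_sub_sum_sq {E ι : Type*} [NormedAddCommGroup E]
    [InnerProductSpace ℝ E] [Fintype ι] {e : ι → E} (he : Orthonormal ℝ e) (S : E →L[ℝ] E)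
    (hS : ∀ f g : E, ⟪S f, g⟫ = ⟪f, S g⟫) {μ : ι → ℝ} (heig : ∀ j, S (S (e j)) = μ j • e j)
    {c : ℝ} (hc : ∀ j, c ≤ μ j) {n : ℕ} (hn : n < Fintype.card ι) (ψ : Fin n → E) :
    ∃ g : E, ‖g‖ = 1 ∧ ∀ β : Fin n → ℝ, c ≤ ‖S g - ∑ i, β i • ψ i‖ ^ 2 := by
  let T : (ι → ℝ) →ₗ[ℝ] (Fin n → ℝ) :=
    LinearMap.pi fun i => (innerₗ E (ψ i)) ∘ₗ S.toLinearMap ∘ₗ Fintype.linearCombination ℝ e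
  have hker : LinearMap.ker T ≠ ⊥ := LinearMap.ker_ne_bot_of_finrank_lt (by simpa using hn)
  obtain ⟨a, haT, ha⟩ := Submodule.exists_mem_ne_zero_of_ne_bot hker
  set g₀ : E := ∑ j, a j • e j with hg₀
  have horth : ∀ i, ⟪ψ i, S g₀⟫ = 0 := fun i => by
    have := congrFun (LinearMap.mem_ker.mp haT) i
    simpa [T, Fintype.linearCombination_apply, hg₀, inner_sum, real_inner_smul_right] using this
  have hg₀_ne : g₀ ≠ 0 := fun h =>
    ha (funext (Fintype.linearIndependent_iff.mp he.linearIndependent a h))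
  have hpos : 0 < ‖g₀‖ := norm_pos_iff.mpr hg₀_ne
  refine ⟨‖g₀‖⁻¹ • g₀, by simp [norm_smul, hpos.ne'], fun β => ?_⟩
  have hw : ⟪S (‖g₀‖⁻¹ • g₀), ∑ i, β i • ψ i⟫ = 0 := by
    simp [inner_sum, real_inner_smul_left, real_inner_smul_right,
      real_inner_comm (ψ _) (S g₀), horth]
  have hlow : c ≤ ‖S (‖g₀‖⁻¹ • g₀)‖ ^ 2 := by
    have h := mul_norm_sq_le_norm_map_sq he S hS heig hc a
    rw [map_smul, norm_smul, norm_inv, norm_norm, mul_pow, inv_pow, inv_mul_eq_div,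
      le_div_iff₀ (by positivity)]
    exact h
  rw [norm_sub_sq_real, hw]
  nlinarith [sq_nonneg ‖∑ i, β i • ψ i‖]

theorem statement4 {X : Type*} [MeasurableSpace X]
    (ρ : Measure X) [IsProbabilityMeasure ρ]
    (Sop : Lp ℝ 2 ρ →L[ℝ] Lp ℝ 2 ρ)
    (μ : ℕ → ℝ) (e : ℕ → Lp ℝ 2 ρ)
    (he : Orthonormal ℝ e)
    (hspan : (Submodule.span ℝ (Set.range e)).topologicalClosure = ⊤)
    (heig : ∀ j, Sop (e j) = μ j • e j)
    (hμmono : Antitone μ) (hμpos : ∀ j, 0 < μ j) (hμsum : Summable μ)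
    (S : Lp ℝ 2 ρ →L[ℝ] Lp ℝ 2 ρ)
    (hSsq : ∀ f, S (S f) = Sop f)
    (hSsa : ∀ f g : Lp ℝ 2 ρ, ⟪S f, g⟫ = ⟪f, S g⟫)
    (hSpos : ∀ f : Lp ℝ 2 ρ, 0 ≤ ⟪f, S f⟫)
    (δ lam : ℝ) (hδ : δ ∈ Set.Ioo (0 : ℝ) 1) (hlam : 0 < lam)
    (n : ℕ) (hn : 0 < n)
    (ψ : Fin n → Lp ℝ 2 ρ)
    (hψnorm : (1 / n : ℝ) * ∑ i, ‖ψ i‖ ^ 2 ≤ 2 * (∑' j, μ j) / δ)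
    (happrox : ∀ g : Lp ℝ 2 ρ, ‖g‖ ≤ 1 →
      (⨅ β : {β : Fin n → ℝ // (∑ i, β i ^ 2) ≤ 4 / n},
        ‖S g - ∑ i, β.1 i • ψ i‖ ^ 2) ≤ 4 * lam) :
    (n : ℝ) ≥ (Nat.card {j : ℕ | 144 * lam ≤ μ j} : ℝ) /
      (4 * Real.log (10 * (∑' j, μ j) / (lam * δ))) := by
  obtain ⟨hδ₀, hδ₁⟩ := hδ
  set s : Set ℕ := {j : ℕ | 144 * lam ≤ μ j} with hs
  rcases Nat.eq_zero_or_pos (Nat.card s) with h0 | hcard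
  · rw [h0]
    simp
  have hfin : Finite s := Nat.finite_of_card_ne_zero hcard.ne'
  have : Fintype s := Fintype.ofFinite s
  have hle : Nat.card s ≤ n := by
    by_contra! hlt
    rw [Nat.card_eq_fintype_card] at hlt
    obtain ⟨g, hg, hfar⟩ := exists_norm_eq_one_forall_le_norm_sub_sum_sq
      (he.comp ((↑) : s → ℕ) Subtype.val_injective) S hSsa (μ := fun j => μ j)
      (fun j => (hSsq _).trans (heig j)) (fun j => j.2) hlt ψ
    have : Nonempty {β : Fin n → ℝ // (∑ i, β i ^ 2) ≤ 4 / n} :=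
      ⟨⟨0, by simp only [Pi.zero_apply]; norm_num; positivity⟩⟩
    have := (le_ciInf fun β : {β : Fin n → ℝ // (∑ i, β i ^ 2) ≤ 4 / n} => hfar β.1).trans
      (happrox g hg.le)
    linarith
  have hlog : 1 ≤ 4 * Real.log (10 * (∑' j, μ j) / (lam * δ)) := by
    obtain ⟨j, hj⟩ : s.Nonempty := Set.nonempty_coe_sort.mp (Finite.card_pos_iff.mp hcard)
    have htr : 144 * lam ≤ ∑' j, μ j :=
      (show 144 * lam ≤ μ j from hj).trans (hμsum.le_tsum j fun i _ => (hμpos i).le)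
    have harg : Real.exp 1 ≤ 10 * (∑' j, μ j) / (lam * δ) := by
      rw [le_div_iff₀ (by positivity)]
      nlinarith [Real.exp_one_lt_d9, mul_pos hlam hδ₀, mul_lt_mul_of_pos_left hδ₁ hlam]
    have := (Real.le_log_iff_exp_le ((Real.exp_pos 1).trans_le harg)).mpr harg
    linarith
  exact (div_le_self (Nat.cast_nonneg _) hlog).trans (Nat.cast_le.mpr hle)
end

section
/- Let (μ_m)_{m≥1} be a non-increasing summable sequence of strictly positive real numbers and λ > 0. Define d(λ) = Σ_{m≥1} μ_m/(μ_m + λ) and m*(λ) = max{m ≥ 1 : μ_m ≥ λ} (with m*(λ) = 0 if the set is empty). Then (1/2) m*(λ) ≤ d(λ) ≤ m*(λ) + (1/λ) Σ_{m : μ_m < λ} μ_m. -/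
/-!
STATEMENT 5: For a non-increasing summable sequence (μ_m)_{m≥1} of strictly positive reals
and λ > 0, with d(λ) = Σ_m μ_m/(μ_m+λ) and m*(λ) = #{m : μ_m ≥ λ},
one has (1/2) m*(λ) ≤ d(λ) ≤ m*(λ) + (1/λ) Σ_{μ_m<λ} μ_m.
(The sequence is indexed by `ℕ`, i.e. `μ m` is the paper's μ_{m+1}.)
-/

theorem statement5 (μ : ℕ → ℝ) (hmono : Antitone μ) (hpos : ∀ m, 0 < μ m)
    (hsum : Summable μ) (lam : ℝ) (hlam : 0 < lam) :
    (1 / 2 : ℝ) * (Nat.card {m : ℕ | lam ≤ μ m} : ℝ) ≤ ∑' m, μ m / (μ m + lam) ∧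
      ∑' m, μ m / (μ m + lam) ≤
        (Nat.card {m : ℕ | lam ≤ μ m} : ℝ) + (1 / lam) * ∑' m : {m : ℕ // μ m < lam}, μ m.1 := by
  have hfin : {m : ℕ | lam ≤ μ m}.Finite := by
    have h := hsum.tendsto_cofinite_zero.eventually (gt_mem_nhds hlam)
    simpa only [Filter.eventually_cofinite, not_lt] using h
  have hterm_le (m : ℕ) : μ m / (μ m + lam) ≤ 1 / lam * μ m := by
    rw [one_div_mul_eq_div]
    exact div_le_div_of_nonneg_left (hpos m).le hlam (by linarith [hpos m])
  have hterm_nonneg (m : ℕ) : 0 ≤ μ m / (μ m + lam) :=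
    div_nonneg (hpos m).le (add_pos (hpos m) hlam).le
  have hd : Summable fun m => μ m / (μ m + lam) :=
    Summable.of_nonneg_of_le hterm_nonneg hterm_le (hsum.mul_left _)
  have hcard : Nat.card {m : ℕ | lam ≤ μ m} = hfin.toFinset.card :=
    Nat.card_eq_card_finite_toFinset hfin
  rw [hcard]
  constructor
  · calc (1 / 2 : ℝ) * hfin.toFinset.card = ∑ _m ∈ hfin.toFinset, (1 / 2 : ℝ) := by
          rw [Finset.sum_const, nsmul_eq_mul, mul_comm]
      _ ≤ ∑ m ∈ hfin.toFinset, μ m / (μ m + lam) := by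
          refine Finset.sum_le_sum fun m hm => ?_
          have hm : lam ≤ μ m := by simpa using hm
          rw [div_le_div_iff₀ two_pos (add_pos (hpos m) hlam)]
          linarith
      _ ≤ ∑' m, μ m / (μ m + lam) := hd.sum_le_tsum _ fun m _ => hterm_nonneg m
  · have hsplit := hd.sum_add_tsum_subtype_compl hfin.toFinset
    have hcompl : ∑' m : {m : ℕ // m ∉ hfin.toFinset}, μ m / (μ m + lam) =
        ∑' m : {m : ℕ // μ m < lam}, μ m / (μ m + lam) :=
      (Equiv.subtypeEquivRight fun m => by simp).tsum_eq
        fun m : {m : ℕ // μ m < lam} => μ m / (μ m + lam)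
    rw [← hsplit, hcompl, ← tsum_mul_left]
    refine add_le_add ?_ (Summable.tsum_le_tsum (fun m => hterm_le m) (hd.subtype _)
      ((hsum.subtype _).mul_left _))
    calc ∑ m ∈ hfin.toFinset, μ m / (μ m + lam) ≤ ∑ _m ∈ hfin.toFinset, (1 : ℝ) :=
          Finset.sum_le_sum fun m _ =>
            div_le_one_of_le₀ (by linarith) (add_pos (hpos m) hlam).le
      _ = hfin.toFinset.card := by simp
end

section
/- Suppose sup_{v∈V} ‖φ(v,·)‖²_{L2(dρ)} < ∞. Let g ∈ L2(dτ) with ‖g‖_{L2(dτ)} ≤ 1 and f = ∫_V g(v) φ(v,·) dτ(v) ∈ L2(dρ). Let v_1,…,v_n be i.i.d. samples from dτ and set α_i = g(v_i)/n. Then E[‖α‖_2²] ≤ 1/n and E[‖f − Σ_{i=1}^n α_i φ(v_i,·)‖²_{L2(dρ)}] ≤ (1/n) sup_{v∈V} ‖φ(v,·)‖²_{L2(dρ)}. -/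
open MeasureTheory
open scoped ENNReal RealInnerProductSpace

/-- Two distinct coordinates of a power of a probability measure are jointly distributed according
to the product measure. -/
lemma measurePreserving_pair_eval {ι V : Type*} [Fintype ι] [MeasurableSpace V] (τ : Measure V)
    [IsProbabilityMeasure τ] {i j : ι} (hij : i ≠ j) :
    MeasurePreserving (fun vs : ι → V => (vs i, vs j)) (Measure.pi fun _ : ι => τ) (τ.prod τ) := by
  refine ⟨by fun_prop, ?_⟩
  have hind := ProbabilityTheory.iIndepFun_pi (μ := fun _ : ι => τ) (X := fun _ v => v)
    (fun _ => aemeasurable_id)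
  have hmap := (ProbabilityTheory.indepFun_iff_map_prod_eq_prod_map_map
    (measurable_pi_apply i).aemeasurable (measurable_pi_apply j).aemeasurable).1
    (hind.indepFun hij)
  rw [hmap, (measurePreserving_eval (fun _ : ι => τ) i).map_eq,
    (measurePreserving_eval (fun _ : ι => τ) j).map_eq]

section HilbertSpace

variable {ι V E : Type*} [Fintype ι] [MeasurableSpace V] {τ : Measure V} [IsProbabilityMeasure τ]
  [NormedAddCommGroup E] [InnerProductSpace ℝ E]

lemma integrable_inner_eval {Z : V → E} (hZ : MemLp Z 2 τ) (i j : ι) :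
    Integrable (fun vs : ι → V => ⟪Z (vs i), Z (vs j)⟫) (Measure.pi fun _ : ι => τ) := by
  have hcomp (k : ι) : MemLp (fun vs : ι → V => Z (vs k)) 2 (Measure.pi fun _ : ι => τ) :=
    hZ.comp_measurePreserving (measurePreserving_eval (fun _ : ι => τ) k)
  exact ((hcomp i).norm.integrable_mul (hcomp j).norm).mono' ((hcomp i).1.inner (hcomp j).1)
    (.of_forall fun _ => norm_inner_le_norm _ _)

variable [CompleteSpace E]

lemma integral_inner_eval_eq_zero {Z : V → E} (hZ : MemLp Z 2 τ) (hmean : ∫ v, Z v ∂τ = 0)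
    {i j : ι} (hij : i ≠ j) :
    ∫ vs : ι → V, ⟪Z (vs i), Z (vs j)⟫ ∂(Measure.pi fun _ : ι => τ) = 0 := by
  have hint : Integrable Z τ := hZ.integrable (by norm_num)
  have hmp := measurePreserving_pair_eval τ hij
  have hmeas : AEStronglyMeasurable (fun p : V × V => ⟪Z p.1, Z p.2⟫) (τ.prod τ) :=
    hZ.1.comp_fst.inner hZ.1.comp_snd
  have hprod : Integrable (fun p : V × V => ⟪Z p.1, Z p.2⟫) (τ.prod τ) :=
    (hint.norm.mul_prod hint.norm).mono' hmeas (.of_forall fun p => norm_inner_le_norm _ _)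
  have hcomp := integral_map (μ := Measure.pi fun _ : ι => τ) hmp.measurable.aemeasurable
    (f := fun p : V × V => ⟪Z p.1, Z p.2⟫) (by rwa [hmp.map_eq])
  rw [← hcomp, hmp.map_eq, integral_prod _ hprod]
  simp [integral_inner hint, hmean]

/-- The second moment of a sum of i.i.d. centred vectors in a Hilbert space. -/
lemma integral_norm_sq_sum_eval {Z : V → E} (hZ : MemLp Z 2 τ) (hmean : ∫ v, Z v ∂τ = 0) :
    ∫ vs : ι → V, ‖∑ i, Z (vs i)‖ ^ 2 ∂(Measure.pi fun _ : ι => τ)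
      = Fintype.card ι * ∫ v, ‖Z v‖ ^ 2 ∂τ := by
  classical
  have hdiag (i : ι) : ∫ vs : ι → V, ⟪Z (vs i), Z (vs i)⟫ ∂(Measure.pi fun _ : ι => τ)
      = ∫ v, ‖Z v‖ ^ 2 ∂τ := by
    simp_rw [real_inner_self_eq_norm_sq]
    exact integral_comp_eval (μ := fun _ : ι => τ) (f := fun v => ‖Z v‖ ^ 2) (hZ.1.norm.pow 2)
  have hoff (i j : ι) : ∫ vs : ι → V, ⟪Z (vs i), Z (vs j)⟫ ∂(Measure.pi fun _ : ι => τ)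
      = if i = j then ∫ v, ‖Z v‖ ^ 2 ∂τ else 0 := by
    split_ifs with h
    · rw [← h, hdiag]
    · exact integral_inner_eval_eq_zero hZ hmean h
  simp_rw [← real_inner_self_eq_norm_sq, sum_inner, inner_sum]
  rw [integral_finsetSum _ fun i _ => integrable_finsetSum _ fun j _ => integrable_inner_eval hZ i j]
  simp_rw [integral_finsetSum _ fun j _ => integrable_inner_eval hZ _ j, hoff]
  simp

lemma integral_norm_sq_sub_integral_le {Y : V → E} (hY : MemLp Y 2 τ) :
    ∫ v, ‖Y v - ∫ w, Y w ∂τ‖ ^ 2 ∂τ ≤ ∫ v, ‖Y v‖ ^ 2 ∂τ := by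
  have hint : Integrable Y τ := hY.integrable (by norm_num)
  have hsq : Integrable (fun v => ‖Y v‖ ^ 2) τ := hY.integrable_norm_pow (by norm_num)
  set m := ∫ w, Y w ∂τ with hm
  have hin : Integrable (fun v => 2 * ⟪m, Y v⟫) τ := (hint.const_inner m).const_mul 2
  have hexp (v : V) : ‖Y v - m‖ ^ 2 = ‖Y v‖ ^ 2 - 2 * ⟪m, Y v⟫ + ‖m‖ ^ 2 := by
    rw [norm_sub_sq_real, real_inner_comm]
  simp_rw [hexp]
  rw [integral_add (by exact hsq.sub hin) (integrable_const _), integral_sub hsq hin, integral_const_mul,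
    integral_inner hint, ← hm, real_inner_self_eq_norm_sq]
  rw [integral_const, probReal_univ, one_smul]
  linarith [sq_nonneg ‖m‖]

/-- The mean square error of the Monte Carlo estimate of a Hilbert space valued integral. -/
lemma integral_norm_sq_integral_sub_average_le {Y : V → E} (hY : MemLp Y 2 τ) {n : ℕ}
    (hn : 0 < n) :
    ∫ vs : Fin n → V, ‖(∫ v, Y v ∂τ) - ∑ i, (n : ℝ)⁻¹ • Y (vs i)‖ ^ 2
        ∂(Measure.pi fun _ : Fin n => τ) ≤ (1 / n) * ∫ v, ‖Y v‖ ^ 2 ∂τ := by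
  have hn' : (n : ℝ) ≠ 0 := by positivity
  have hint : Integrable Y τ := hY.integrable (by norm_num)
  set m := ∫ w, Y w ∂τ with hm
  have hZ : MemLp (fun v => Y v - m) 2 τ := hY.sub (memLp_const m)
  have hmean : ∫ v, (Y v - m) ∂τ = 0 := by
    rw [integral_sub hint (integrable_const _)]
    simp [hm]
  have hrew (vs : Fin n → V) : ‖m - ∑ i, (n : ℝ)⁻¹ • Y (vs i)‖ ^ 2
      = ((n : ℝ)⁻¹) ^ 2 * ‖∑ i, (Y (vs i) - m)‖ ^ 2 := by
    have hdiff : m - ∑ i, (n : ℝ)⁻¹ • Y (vs i) = -((n : ℝ)⁻¹ • ∑ i, (Y (vs i) - m)) := by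
      rw [Finset.sum_sub_distrib, smul_sub, ← Finset.smul_sum]
      simp [← Nat.cast_smul_eq_nsmul ℝ, smul_smul, hn']
    rw [hdiff, norm_neg, norm_smul, mul_pow, Real.norm_eq_abs, sq_abs]
  simp_rw [hrew]
  rw [integral_const_mul, integral_norm_sq_sum_eval hZ hmean, Fintype.card_fin, ← mul_assoc,
    show ((n : ℝ)⁻¹) ^ 2 * n = 1 / n by field_simp]
  exact mul_le_mul_of_nonneg_left (integral_norm_sq_sub_integral_le hY) (by positivity)

end HilbertSpace

lemma integral_sq_le_one_of_norm_le_one {V : Type*} [MeasurableSpace V] {τ : Measure V}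
    (g : Lp ℝ 2 τ) (hg : ‖g‖ ≤ 1) : ∫ v, (g : V → ℝ) v ^ 2 ∂τ ≤ 1 := by
  have h : ∫ v, (g : V → ℝ) v ^ 2 ∂τ = ‖g‖ ^ 2 := by
    rw [← real_inner_self_eq_norm_sq, L2.inner_def]
    simp [pow_two]
  rw [h]
  exact pow_le_one₀ (norm_nonneg g) hg

/-!
STATEMENT 12: Suppose sup_v ‖φ(v,·)‖²_{L²(dρ)} < ∞.  Let g ∈ L²(dτ) with ‖g‖ ≤ 1 and
f = ∫_V g(v)φ(v,·)dτ(v).  For v_1,…,v_n i.i.d. from dτ and α_i = g(v_i)/n,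
E[‖α‖₂²] ≤ 1/n  and  E[‖f − Σ_i α_i φ(v_i,·)‖²_{L²(dρ)}] ≤ (1/n) sup_v ‖φ(v,·)‖².
The i.i.d. sample is modelled by the product measure τ^⊗n on (Fin n → V).
-/

theorem statement12 {X V : Type*} [MeasurableSpace X] [MeasurableSpace V]
    (ρ : Measure X) [IsProbabilityMeasure ρ] (τ : Measure V) [IsProbabilityMeasure τ]
    (φ : V → Lp ℝ 2 ρ) (hφmeas : AEStronglyMeasurable φ τ)
    (hbdd : BddAbove (Set.range fun v => ‖φ v‖ ^ 2))
    (g : Lp ℝ 2 τ) (hg : ‖g‖ ≤ 1)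
    (n : ℕ) (hn : 0 < n) :
    (∫ vs : Fin n → V, ∑ i, ((g : V → ℝ) (vs i) / n) ^ 2
        ∂(Measure.pi fun _ : Fin n => τ)) ≤ 1 / n ∧
      (∫ vs : Fin n → V,
          ‖(∫ v, (g : V → ℝ) v • φ v ∂τ) - ∑ i, ((g : V → ℝ) (vs i) / n) • φ (vs i)‖ ^ 2
          ∂(Measure.pi fun _ : Fin n => τ))
        ≤ (1 / n) * ⨆ v, ‖φ v‖ ^ 2 := by
  have hgmem : MemLp (g : V → ℝ) 2 τ := Lp.memLp g
  have hg_sq : Integrable (fun v => (g : V → ℝ) v ^ 2) τ := hgmem.integrable_sq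
  have hg_le := integral_sq_le_one_of_norm_le_one g hg
  have hn' : (n : ℝ) ≠ 0 := by positivity
  set S := ⨆ v, ‖φ v‖ ^ 2 with hS
  have hφS (v : V) : ‖φ v‖ ^ 2 ≤ S := le_ciSup hbdd v
  have hS0 : 0 ≤ S := Real.iSup_nonneg fun v => sq_nonneg _
  constructor
  · have heval (i : Fin n) : ∫ vs : Fin n → V, ((g : V → ℝ) (vs i) / n) ^ 2
        ∂(Measure.pi fun _ : Fin n => τ) = (∫ v, (g : V → ℝ) v ^ 2 ∂τ) / n ^ 2 := by
      simp_rw [div_pow]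
      rw [integral_div, integral_comp_eval (μ := fun _ : Fin n => τ)
        (f := fun v => (g : V → ℝ) v ^ 2) hg_sq.1]
    have hint (i : Fin n) : Integrable (fun vs : Fin n → V => ((g : V → ℝ) (vs i) / n) ^ 2)
        (Measure.pi fun _ : Fin n => τ) := by
      simp_rw [div_pow]
      exact (integrable_comp_eval (μ := fun _ : Fin n => τ) (i := i) hg_sq).div_const _
    rw [integral_finsetSum _ fun i _ => hint i]
    simp_rw [heval]
    rw [Finset.sum_const, Finset.card_univ, Fintype.card_fin, nsmul_eq_mul,
      show (n : ℝ) * ((∫ v, (g : V → ℝ) v ^ 2 ∂τ) / n ^ 2) = (∫ v, (g : V → ℝ) v ^ 2 ∂τ) / n by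
        field_simp]
    gcongr
  · have hφ_top : MemLp φ ∞ τ := memLp_top_of_bound hφmeas (√S)
      (.of_forall fun v => Real.le_sqrt_of_sq_le (hφS v))
    have hY : MemLp (fun v => (g : V → ℝ) v • φ v) 2 τ := hφ_top.smul hgmem
    have hsecond : ∫ v, ‖(g : V → ℝ) v • φ v‖ ^ 2 ∂τ ≤ S := by
      calc ∫ v, ‖(g : V → ℝ) v • φ v‖ ^ 2 ∂τ ≤ ∫ v, (g : V → ℝ) v ^ 2 * S ∂τ := by
            refine integral_mono (hY.integrable_norm_pow (by norm_num)) (hg_sq.mul_const S)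
              fun v => ?_
            simp only [norm_smul, mul_pow, Real.norm_eq_abs, sq_abs]
            exact mul_le_mul_of_nonneg_left (hφS v) (sq_nonneg _)
        _ = (∫ v, (g : V → ℝ) v ^ 2 ∂τ) * S := integral_mul_const _ _
        _ ≤ S := mul_le_of_le_one_left hS0 hg_le
    have hmc := integral_norm_sq_integral_sub_average_le hY hn
    simp_rw [smul_smul, inv_mul_eq_div] at hmc
    exact hmc.trans (mul_le_mul_of_nonneg_left hsecond (by positivity))
end

section
/- Let g ∈ L2(dτ) with ‖g‖_{L2(dτ)} ≤ 1 and f = ∫_V g(v) φ(v,·) dτ(v) ∈ L2(dρ). Then the rank-one operator f ⊗ f is dominated by Σ in the operator order: for every a ∈ L2(dρ), ⟨a, f⟩²_{L2(dρ)} ≤ ⟨a, Σ a⟩_{L2(dρ)}. -/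
open MeasureTheory
open scoped ENNReal RealInnerProductSpace

/-!
STATEMENT 15: With k(x,y) = ∫_V φ(v,x)φ(v,y)dτ(v) and Σ the associated integral operator
on L²(dρ) (so that ⟨a, Σb⟩ = ∫_V ⟨a, φ(v,·)⟩⟨φ(v,·), b⟩ dτ(v)), if g ∈ L²(dτ) with
‖g‖ ≤ 1 and f = ∫_V g(v) φ(v,·) dτ(v), then the rank-one operator f ⊗ f is dominated by Σ:
for every a ∈ L²(dρ), ⟨a, f⟩² ≤ ⟨a, Σa⟩.
Here `φ v` denotes the feature function φ(v,·) as an element of L²(dρ).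
-/

theorem statement15 {X V : Type*} [MeasurableSpace X] [MeasurableSpace V]
    (ρ : Measure X) [IsProbabilityMeasure ρ] (τ : Measure V) [IsProbabilityMeasure τ]
    (φ : V → Lp ℝ 2 ρ) (hφmeas : AEStronglyMeasurable φ τ)
    (hφint : Integrable (fun v => ‖φ v‖ ^ 2) τ)
    (Sop : Lp ℝ 2 ρ →L[ℝ] Lp ℝ 2 ρ)
    (hSop : ∀ a b : Lp ℝ 2 ρ, ⟪a, Sop b⟫ = ∫ v, ⟪a, φ v⟫ * ⟪φ v, b⟫ ∂τ)
    (g : Lp ℝ 2 τ) (hg : ‖g‖ ≤ 1)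
    (f : Lp ℝ 2 ρ) (hf : f = ∫ v, (g : V → ℝ) v • φ v ∂τ) :
    ∀ a : Lp ℝ 2 ρ, ⟪a, f⟫ ^ 2 ≤ ⟪a, Sop a⟫ := by
  intro a
  have hφ : MemLp φ 2 τ := (memLp_two_iff_integrable_sq_norm hφmeas).2 hφint
  have hgφ : Integrable (fun v => (g : V → ℝ) v • φ v) τ :=
    memLp_one_iff_integrable.1 (hφ.smul (Lp.memLp g))
  have hh : MemLp (fun v => ⟪a, φ v⟫) 2 τ := hφ.const_inner a
  have hinner : ⟪a, f⟫ = ⟪g, hh.toLp _⟫ := by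
    rw [hf, ← integral_inner hgφ, L2.inner_def]
    refine integral_congr_ae ?_
    filter_upwards [hh.coeFn_toLp] with v hv
    rw [hv, real_inner_smul_right, RCLike.inner_apply', conj_trivial]
  have hnorm : ⟪a, Sop a⟫ = ‖hh.toLp _‖ ^ 2 := by
    rw [hSop, ← real_inner_self_eq_norm_sq, L2.inner_def]
    refine integral_congr_ae ?_
    filter_upwards [hh.coeFn_toLp] with v hv
    rw [hv, RCLike.inner_apply', conj_trivial, real_inner_comm a]
  rw [hinner, hnorm, sq_le_sq, abs_norm]
  calc |⟪g, hh.toLp _⟫| ≤ ‖g‖ * ‖hh.toLp _‖ := abs_real_inner_le_norm _ _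
    _ ≤ ‖hh.toLp _‖ := mul_le_of_le_one_left (norm_nonneg _) hg
end

section
/- Let H be a Hilbert space, A and B bounded positive self-adjoint operators on H, λ > 0 and t ∈ (0,1). If (A + λI)^{-1/2} (B − A) (A + λI)^{-1/2} ⪰ −t I (i.e., ⟨h, (A+λI)^{-1/2}(B−A)(A+λI)^{-1/2} h⟩ ≥ −t‖h‖² for all h ∈ H), then (B + λI)^{-1} ⪯ (1−t)^{-1} (A + λI)^{-1}; in particular, for every f ∈ H, ⟨f, (B + λI)^{-1} f⟩ ≤ (1−t)^{-1} ⟨f, (A + λI)^{-1} f⟩. -/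
open scoped RealInnerProductSpace

/-!
STATEMENT 16: H Hilbert, A, B bounded positive self-adjoint, λ > 0, t ∈ (0,1).
If (A+λI)^{-1/2}(B−A)(A+λI)^{-1/2} ⪰ −tI then (B+λI)⁻¹ ⪯ (1−t)⁻¹(A+λI)⁻¹,
i.e. for all f, ⟨f,(B+λI)⁻¹f⟩ ≤ (1−t)⁻¹⟨f,(A+λI)⁻¹f⟩.
The inverses (A+λI)⁻¹, (B+λI)⁻¹ are encoded by `RA`, `RB` with two-sided inverse
properties, and (A+λI)^{-1/2} by the positive self-adjoint operator `Q` with Q² = RA.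
-/

theorem statement16 {H : Type*} [NormedAddCommGroup H] [InnerProductSpace ℝ H]
    [CompleteSpace H]
    (A B : H →L[ℝ] H) (hA : IsSelfAdjoint A) (hB : IsSelfAdjoint B)
    (hApos : ∀ h : H, 0 ≤ ⟪h, A h⟫) (hBpos : ∀ h : H, 0 ≤ ⟪h, B h⟫)
    (lam t : ℝ) (hlam : 0 < lam) (ht : t ∈ Set.Ioo (0 : ℝ) 1)
    (RA RB Q : H →L[ℝ] H)
    (hRA : ∀ h : H, A (RA h) + lam • RA h = h) (hRA' : ∀ h : H, RA (A h + lam • h) = h)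
    (hRB : ∀ h : H, B (RB h) + lam • RB h = h) (hRB' : ∀ h : H, RB (B h + lam • h) = h)
    (hQ : IsSelfAdjoint Q) (hQpos : ∀ h : H, 0 ≤ ⟪h, Q h⟫)
    (hQsq : ∀ h : H, Q (Q h) = RA h)
    (hlow : ∀ h : H, -t * ‖h‖ ^ 2 ≤ ⟪h, Q (B (Q h)) - Q (A (Q h))⟫) :
    ∀ f : H, ⟪f, RB f⟫ ≤ (1 - t)⁻¹ * ⟪f, RA f⟫ := by
  intro f
  have hQsym : ∀ x y : H, ⟪Q x, y⟫ = ⟪x, Q y⟫ := hQ.isSymmetric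
  set u := RB f with hu
  obtain ⟨v, hv⟩ : ∃ v, v = Q (A u + lam • u) := ⟨_, rfl⟩
  have hQv : Q v = u := by rw [hv, hQsq, hRA']
  have hv_norm : ‖v‖ ^ 2 = ⟪u, A u⟫ + lam * ‖u‖ ^ 2 := by
    rw [← real_inner_self_eq_norm_sq v]
    nth_rewrite 2 [hv]
    rw [← hQsym, hQv, inner_add_right, inner_smul_right, real_inner_self_eq_norm_sq]
  have huf : ⟪u, f⟫ = ⟪u, B u⟫ + lam * ‖u‖ ^ 2 := by
    nth_rewrite 1 [← hRB f]
    rw [← hu, inner_add_right, inner_smul_right, real_inner_self_eq_norm_sq]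
  have hlower : (1 - t) * ‖v‖ ^ 2 ≤ ⟪u, f⟫ := by
    have h := hlow v
    rw [inner_sub_right, ← hQsym, ← hQsym, hQv] at h
    linarith
  have hQf_norm : ‖Q f‖ ^ 2 = ⟪f, RA f⟫ := by
    rw [← real_inner_self_eq_norm_sq, hQsym, hQsq]
  have hQf_inner : ⟪Q f, v⟫ = ⟪u, f⟫ := by
    rw [hQsym, hQv, real_inner_comm]
  have hsq : 0 ≤ ‖Q f - (1 - t) • v‖ ^ 2 := sq_nonneg _
  rw [norm_sub_sq_real, inner_smul_right, norm_smul, mul_pow, Real.norm_eq_abs, sq_abs,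
    hQf_norm, hQf_inner] at hsq
  have ht' : 0 < 1 - t := sub_pos.mpr ht.2
  rw [real_inner_comm, inv_mul_eq_div, le_div_iff₀ ht']
  nlinarith [mul_le_mul_of_nonneg_left hlower ht'.le]
end

section
/- Let H be a separable Hilbert space, Σ a bounded injective positive self-adjoint operator on H, Σ̂ a bounded positive self-adjoint operator on H, λ > 0 and r ∈ [0, 1/2]. Assume (Σ̂ + λI)^{-1} ⪯ 4 (Σ + λI)^{-1}. Let h = Σ^{1/2} u with ‖u‖ ≤ 1, and define ĥ = Σ^{1/2} Σ̂ (Σ̂ + λI)^{-1} u. Then Σ^{-r}(ĥ − h) is well defined (equal to −λ Σ^{1/2−r} (Σ̂ + λI)^{-1} u) and ‖Σ^{-r}(ĥ − h)‖ ≤ 2 λ^{1/2 − r}, where fractional powers of Σ are defined by the continuous functional calculus. -/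
open scoped RealInnerProductSpace

/-!
STATEMENT 18: H separable Hilbert, Σ bounded injective positive self-adjoint, Σ̂ bounded
positive self-adjoint, λ > 0, r ∈ [0,1/2], with (Σ̂+λI)⁻¹ ⪯ 4(Σ+λI)⁻¹.  For h = Σ^{1/2} u
with ‖u‖ ≤ 1 and ĥ = Σ^{1/2} Σ̂ (Σ̂+λI)⁻¹ u, the element Σ^{-r}(ĥ−h) is well defined, equal
to −λ Σ^{1/2−r} (Σ̂+λI)⁻¹ u (i.e. Σ^r maps the latter to ĥ−h), and
‖Σ^{-r}(ĥ−h)‖ ≤ 2 λ^{1/2−r}.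
The fractional powers of Σ (continuous functional calculus) are encoded by the family
`P : ℝ → (H →L H)`, r ↦ Σ^r (positive self-adjoint, P 1 = Σ, semigroup on nonnegative
exponents, strongly continuous); the inverses (Σ+λI)⁻¹ and (Σ̂+λI)⁻¹ by `RS` and `Rhat`.
-/

/-- A continuous nonnegative function on `[0, 1]` which is midpoint log-convex and at most `1` at
both endpoints is at most `1` on the whole interval. -/
lemma le_one_of_midpoint_logConvex {g : ℝ → ℝ} (hg : Continuous g)
    (hnonneg : ∀ t ∈ Set.Icc (0 : ℝ) 1, 0 ≤ g t) (h0 : g 0 ≤ 1) (h1 : g 1 ≤ 1)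
    (hmid : ∀ a ∈ Set.Icc (0 : ℝ) 1, ∀ b ∈ Set.Icc (0 : ℝ) 1,
      g ((a + b) / 2) ^ 2 ≤ g a * g b) :
    ∀ t ∈ Set.Icc (0 : ℝ) 1, g t ≤ 1 := by
  obtain ⟨m, hm, hmax⟩ := isCompact_Icc.exists_isMaxOn
    (Set.nonempty_Icc.2 (zero_le_one' ℝ)) hg.continuousOn
  suffices hgm : g m ≤ 1 from fun t ht => (hmax ht).trans hgm
  have h0mem : (0 : ℝ) ∈ Set.Icc (0 : ℝ) 1 := by simp
  have h1mem : (1 : ℝ) ∈ Set.Icc (0 : ℝ) 1 := by simp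
  have key : g m ^ 2 ≤ g m := by
    rcases le_total m (1 / 2) with h | h
    · have hb : 2 * m ∈ Set.Icc (0 : ℝ) 1 := ⟨by linarith [hm.1], by linarith⟩
      have h2 := hmid 0 h0mem (2 * m) hb
      rw [show (0 + 2 * m) / 2 = m by ring] at h2
      have h3 : g (2 * m) ≤ g m := hmax hb
      nlinarith [hnonneg _ hb]
    · have hb : 2 * m - 1 ∈ Set.Icc (0 : ℝ) 1 := ⟨by linarith, by linarith [hm.2]⟩
      have h2 := hmid 1 h1mem (2 * m - 1) hb
      rw [show (1 + (2 * m - 1)) / 2 = m by ring] at h2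
      have h3 : g (2 * m - 1) ≤ g m := hmax hb
      nlinarith [hnonneg _ hb]
  nlinarith

/-- If `B` is positive self-adjoint with right inverse `R`, and `R ⪯ 4 S` with `S` a left
inverse of `A`, then `A ⪯ 4 B`. -/
lemma inner_le_four_mul_inner_of_inverse_le {H : Type*} [NormedAddCommGroup H]
    [InnerProductSpace ℝ H] {A B R S : H →L[ℝ] H}
    (hBsymm : ∀ x y : H, ⟪B x, y⟫ = ⟪x, B y⟫) (hBpos : ∀ x : H, 0 ≤ ⟪x, B x⟫)
    (hR : ∀ x, B (R x) = x) (hS : ∀ x, S (A x) = x)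
    (hle : ∀ x : H, ⟪x, R x⟫ ≤ 4 * ⟪x, S x⟫) (w : H) :
    ⟪w, A w⟫ ≤ 4 * ⟪w, B w⟫ := by
  have h1 := hBpos (R (A w) - (4 : ℝ) • w)
  have h2 := hle (A w)
  have h3 : ⟪R (A w), B w⟫ = ⟪A w, w⟫ := by rw [← hBsymm, hR]
  rw [hS] at h2
  simp only [map_sub, map_smul, hR, inner_sub_left, inner_sub_right, real_inner_smul_left,
    real_inner_smul_right, h3] at h1
  linarith [real_inner_comm (A w) (R (A w)), real_inner_comm w (A w)]

theorem statement18 {H : Type*} [NormedAddCommGroup H] [InnerProductSpace ℝ H]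
    [CompleteSpace H] [TopologicalSpace.SeparableSpace H]
    (Sig Sighat : H →L[ℝ] H)
    (hSig : IsSelfAdjoint Sig) (hSigpos : ∀ h : H, 0 ≤ ⟪h, Sig h⟫)
    (hSiginj : Function.Injective Sig)
    (hSighat : IsSelfAdjoint Sighat) (hSighatpos : ∀ h : H, 0 ≤ ⟪h, Sighat h⟫)
    (P : ℝ → H →L[ℝ] H)
    (hP1 : P 1 = Sig)
    (hPsa : ∀ r : ℝ, 0 ≤ r → IsSelfAdjoint (P r))
    (hPpos : ∀ r : ℝ, 0 ≤ r → ∀ h : H, 0 ≤ ⟪h, P r h⟫)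
    (hPadd : ∀ a b : ℝ, 0 ≤ a → 0 ≤ b → ∀ h : H, P a (P b h) = P (a + b) h)
    (hPcont : ∀ h : H, Continuous fun t : ℝ => P t h)
    (lam r : ℝ) (hlam : 0 < lam) (hr : r ∈ Set.Icc (0 : ℝ) (1 / 2))
    (RS : H →L[ℝ] H)
    (hRS : ∀ h : H, Sig (RS h) + lam • RS h = h)
    (hRS' : ∀ h : H, RS (Sig h + lam • h) = h)
    (Rhat : H →L[ℝ] H)
    (hRhat : ∀ h : H, Sighat (Rhat h) + lam • Rhat h = h)
    (hRhat' : ∀ h : H, Rhat (Sighat h + lam • h) = h)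
    (hdom : ∀ h : H, ⟪h, Rhat h⟫ ≤ 4 * ⟪h, RS h⟫)
    (u : H) (hu : ‖u‖ ≤ 1) :
    P r ((-lam) • P (1 / 2 - r) (Rhat u))
        = P (1 / 2) (Sighat (Rhat u)) - P (1 / 2) u ∧
      ‖(-lam) • P (1 / 2 - r) (Rhat u)‖ ≤ 2 * lam ^ (1 / 2 - r) := by
  obtain ⟨hr0, hr1⟩ := hr
  set v := Rhat u with hv
  have hsymm : ∀ t : ℝ, 0 ≤ t → ∀ x y : H, ⟪P t x, y⟫ = ⟪x, P t y⟫ := fun t ht x y =>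
    (hPsa t ht).isSymmetric x y
  have hvu : Sighat v + lam • v = u := hRhat u
  have hP0 : ∀ x, P 0 x = x := fun x => hSiginj (by
    rw [← hP1, hPadd 1 0 zero_le_one le_rfl, add_zero])
  refine ⟨?_, ?_⟩
  · rw [map_smul, hPadd r (1 / 2 - r) hr0 (by linarith), add_sub_cancel, ← map_sub, ← map_smul]
    congr 1
    rw [← hvu]
    module
  have huv : lam * ‖v‖ ^ 2 ≤ ⟪v, u⟫ := by
    have h1 := hSighatpos v
    have h2 : ⟪v, u⟫ = ⟪v, Sighat v⟫ + lam * ‖v‖ ^ 2 := by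
      rw [← real_inner_self_eq_norm_sq, ← real_inner_smul_right, ← inner_add_right, hvu]
    linarith
  have hcs : ⟪v, u⟫ ≤ ‖v‖ :=
    (real_inner_le_norm v u).trans (mul_le_of_le_one_right (norm_nonneg v) hu)
  have hnv : lam * ‖v‖ ≤ 1 := by
    rcases (norm_nonneg v).eq_or_lt with h | h
    · rw [← h]; simp
    · nlinarith
  have hSv : lam * ⟪v, Sig v⟫ ≤ 4 := by
    have h := inner_le_four_mul_inner_of_inverse_le
      (A := Sig + lam • ContinuousLinearMap.id ℝ H)
      (B := Sighat + lam • ContinuousLinearMap.id ℝ H) (R := Rhat) (S := RS)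
      (fun x y => by
        have h : ⟪Sighat x, y⟫ = ⟪x, Sighat y⟫ := hSighat.isSymmetric x y
        simp [inner_add_left, inner_add_right, real_inner_smul_left, real_inner_smul_right, h])
      (fun x => by
        have h1 := hSighatpos x
        have h2 : 0 ≤ ⟪x, x⟫ := real_inner_self_nonneg
        simp only [add_apply, smul_apply,
          ContinuousLinearMap.id_apply, inner_add_right, real_inner_smul_right]
        positivity)
      (fun x => by simpa using hRhat x) (fun x => by simpa using hRS' x) hdom v
    simp only [add_apply, smul_apply,
      ContinuousLinearMap.id_apply, hvu, inner_add_right (𝕜 := ℝ) v (Sig v),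
      real_inner_smul_right] at h
    have h2 : 0 ≤ lam * ⟪v, v⟫ := mul_nonneg hlam.le real_inner_self_nonneg
    nlinarith
  have h4 : 0 < 4 * lam := by positivity
  have hinterp := le_one_of_midpoint_logConvex
    (g := fun t => lam ^ 2 * ⟪v, P t v⟫ * (4 * lam) ^ (-t))
    ((continuous_const.mul (continuous_const.inner (hPcont v))).mul
      (Real.continuous_const_rpow h4.ne' |>.comp continuous_neg))
    (fun t ht => by have := hPpos t ht.1 v; positivity)
    (by
      simp only [hP0, neg_zero, Real.rpow_zero, mul_one, real_inner_self_eq_norm_sq, ← mul_pow]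
      exact pow_le_one₀ (by positivity) hnv)
    (by
      simp only [hP1, Real.rpow_neg_one]
      rw [← div_eq_mul_inv, div_le_one h4]
      nlinarith)
    (fun a ha b hb => by
      have ha2 : 0 ≤ a / 2 := by linarith [ha.1]
      have hb2 : 0 ≤ b / 2 := by linarith [hb.1]
      have hsq : ⟪v, P ((a + b) / 2) v⟫ ^ 2 ≤ ⟪v, P a v⟫ * ⟪v, P b v⟫ := by
        have h := real_inner_mul_inner_self_le (P (a / 2) v) (P (b / 2) v)
        rw [hsymm _ ha2, hsymm _ ha2, hsymm _ hb2, hPadd _ _ ha2 hb2, hPadd _ _ ha2 ha2,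
          hPadd _ _ hb2 hb2, add_halves, add_halves, ← add_div] at h
        rwa [sq]
      have hpow : ((4 * lam) ^ (-((a + b) / 2))) ^ 2 = (4 * lam) ^ (-a) * (4 * lam) ^ (-b) := by
        rw [sq, ← Real.rpow_add h4, ← Real.rpow_add h4]
        congr 1
        ring
      calc _ = lam ^ 4 * ((4 * lam) ^ (-a) * (4 * lam) ^ (-b)) *
              ⟪v, P ((a + b) / 2) v⟫ ^ 2 := by rw [← hpow]; ring
        _ ≤ lam ^ 4 * ((4 * lam) ^ (-a) * (4 * lam) ^ (-b)) *
              (⟪v, P a v⟫ * ⟪v, P b v⟫) := by gcongr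
        _ = _ := by ring)
  set s := 1 / 2 - r with hs
  have hs0 : 0 ≤ s := by linarith
  have hs1 : s + s ≤ 1 := by linarith
  have hmain := hinterp (s + s) ⟨by linarith, hs1⟩
  simp only [Real.rpow_neg h4.le] at hmain
  rw [← div_eq_mul_inv, div_le_one (by positivity), ← hPadd s s hs0 hs0, ← hsymm s hs0,
    real_inner_self_eq_norm_sq, Real.mul_rpow (by norm_num) hlam.le, Real.rpow_add hlam] at hmain
  have h4s : (4 : ℝ) ^ (s + s) ≤ 4 := by
    simpa using Real.rpow_le_rpow_of_exponent_le (x := 4) (by norm_num) hs1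
  have hls : 0 < lam ^ s := by positivity
  rw [norm_smul, norm_neg, Real.norm_of_nonneg hlam.le]
  refine (sq_le_sq₀ (by positivity) (by positivity)).1 ?_
  nlinarith [mul_le_mul_of_nonneg_right h4s (mul_pos hls hls).le]
end
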